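/- For every r > 2 there is a constant C depending only on r such that the following holds for all ε ∈ (0,1], t ∈ [0,ε], τ > 0. Let w̄ = (w̄_ξ)_{ξ∈ℝ} be a family of continuously differentiable functions w̄_ξ : [0,∞) → ℂ with w̄_ξ(0) = 0, and A = (A_ξ)_{ξ∈ℝ} ⊂ ℂ, for which all norms below are finite and all integrals converge absolutely. Define D_ξ = −iξ c_{θ,ξ} A_ξ + iξ I_∞[w̄_ξ] − iξ|ξ| A_ξ − i∫_ℝ A_η (ξ−η) A_{ξ−η} dη, and ℬ_ξ(y) = A_ξ( ∂_t θ_ξ(y) − ∂_{yy}θ_ξ(y) ) + (θ_ξ(y) − 1) D_ξ + iξ( I_∞[w̄_ξ] − I_y[w̄_ξ] ) + iξ A_ξ( y(θ_ξ(y) − 1) − ∫_y^∞ (1−θ_ξ(y'))dy' ) + i∫_ℝ( (ξ−η)A_η A_{ξ−η}(θ_η(y)θ_{ξ−η}(y) − 1) − η A_η A_{ξ−η} I_y[θ_η] ∂_yθ_{ξ−η}(y) )dη, and set T_ℬ = ∫_ℝ∫_0^∞ ℬ_ξ(y) conj(w̄_ξ(y)) ρ(y)² e^{2τ|ξ|}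 ⟨ξ⟩^{2r} dy dξ. Then |T_ℬ| ≤ C ( ε⁻¹ ‖w̄‖_{τ,r} ‖A‖~_{τ,r} + ‖⟨∂ₓ⟩^{1/2} A‖~_{τ,r} ‖∂_y w̄‖_{τ,r} + ‖|∂ₓ|^{1/2} w̄‖²_{τ,r} + ‖|∂ₓ|^{1/2} w̄‖_{τ,r} ‖w̄‖_{τ,r} + ‖⟨∂ₓ⟩^{1/2} w̄‖_{τ,r} ‖|∂ₓ|^{1/2} A‖~_{τ,r} ‖A‖~_{τ,r} ). -/

import Mathlib

open MeasureTheory Set Filter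

noncomputable section

/-- Gaussian weight `ρ(y) = exp(y²/(8(1+t/ε)))`. -/
def rho (ε t y : ℝ) : ℝ := Real.exp (y ^ 2 / (8 * (1 + t / ε)))

/-- Japanese bracket `⟨ξ⟩ = √(1+ξ²)`. -/
def brak (ξ : ℝ) : ℝ := Real.sqrt (1 + ξ ^ 2)

/-- Combined weight `ρ(y)² e^{2τ|ξ|} ⟨ξ⟩^{2s}` in the squared analytic norms. -/
def wgt (ε t τ s ξ y : ℝ) : ℝ :=
  (rho ε t y) ^ 2 * Real.exp (2 * τ * |ξ|) * brak ξ ^ (2 * s)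

/-- Weight `e^{2τ|ξ|} ⟨ξ⟩^{2s}` for the squared analytic norms of boundary data. -/
def aWgt (τ s ξ : ℝ) : ℝ := Real.exp (2 * τ * |ξ|) * brak ξ ^ (2 * s)

/-- Analytic norm `‖w‖_{τ,s}` (with Fourier multiplier `m`):
`(∫_ℝ ∫_0^∞ m(ξ) ρ(y)² |w_ξ(y)|² e^{2τ|ξ|} ⟨ξ⟩^{2s} dy dξ)^{1/2}`. -/
def wNorm (ε t τ s : ℝ) (m : ℝ → ℝ) (w : ℝ → ℝ → ℂ) : ℝ :=
  Real.sqrt (∫ ξ : ℝ, ∫ y in Ioi (0 : ℝ), m ξ * ‖w ξ y‖ ^ 2 * wgt ε t τ s ξ y)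

/-- Analytic norm `‖A‖~_{τ,s}` (with Fourier multiplier `m`):
`(∫_ℝ m(ξ) |A_ξ|² e^{2τ|ξ|} ⟨ξ⟩^{2s} dξ)^{1/2}`. -/
def aNorm (τ s : ℝ) (m : ℝ → ℝ) (A : ℝ → ℂ) : ℝ :=
  Real.sqrt (∫ ξ : ℝ, m ξ * ‖A ξ‖ ^ 2 * aWgt τ s ξ)

/-- Finiteness of the squared norm `‖·‖_{τ,s}` with multiplier `m`. -/
def wFinite (ε t τ s : ℝ) (m : ℝ → ℝ) (w : ℝ → ℝ → ℂ) : Prop :=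
  Integrable (fun p : ℝ × ℝ => m p.1 * ‖w p.1 p.2‖ ^ 2 * wgt ε t τ s p.1 p.2)
    ((volume : Measure ℝ).prod ((volume : Measure ℝ).restrict (Ioi 0)))

/-- Finiteness of the squared norm `‖·‖~_{τ,s}` with multiplier `m`. -/
def aFinite (τ s : ℝ) (m : ℝ → ℝ) (A : ℝ → ℂ) : Prop :=
  Integrable (fun ξ : ℝ => m ξ * ‖A ξ‖ ^ 2 * aWgt τ s ξ) (volume : Measure ℝ)

/-- Lift function `θ_ξ(y) = 1 − exp(−y²⟨ξ⟩²/(2(1+t/ε)))`. -/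
def theta (ε t ξ y : ℝ) : ℝ :=
  1 - Real.exp (-(y ^ 2 * (1 + ξ ^ 2)) / (2 * (1 + t / ε)))

/-- Time derivative of the lift:
`∂_t θ_ξ(y) = −(y²⟨ξ⟩²/(2ε(1+t/ε)²)) exp(−y²⟨ξ⟩²/(2(1+t/ε)))`. -/
def dtTheta (ε t ξ y : ℝ) : ℝ :=
  -(y ^ 2 * (1 + ξ ^ 2) / (2 * ε * (1 + t / ε) ^ 2)) *
    Real.exp (-(y ^ 2 * (1 + ξ ^ 2)) / (2 * (1 + t / ε)))

/-- `c_{θ,ξ} = √(π(1+t/ε))/(2⟨ξ⟩)`. -/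
def cTheta (ε t ξ : ℝ) : ℝ := Real.sqrt (Real.pi * (1 + t / ε)) / (2 * brak ξ)

/-- `I_y[h] = ∫_0^y h`. -/
def Iy (h : ℝ → ℂ) (y : ℝ) : ℂ := ∫ y' in (0 : ℝ)..y, h y'

/-- `I_y[h] = ∫_0^y h` (real-valued version). -/
def IyR (h : ℝ → ℝ) (y : ℝ) : ℝ := ∫ y' in (0 : ℝ)..y, h y'

/-- `I_∞[h] = ∫_0^∞ h`. -/
def Iinf (h : ℝ → ℂ) : ℂ := ∫ y' in Ioi (0 : ℝ), h y'

/-- Right-hand side `D_ξ` of the forced Benjamin–Ono evolution `∂_t A_ξ = D_ξ`. -/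
def Dbo (ε t : ℝ) (w : ℝ → ℝ → ℂ) (A : ℝ → ℂ) (ξ : ℝ) : ℂ :=
  -Complex.I * (ξ : ℂ) * ((cTheta ε t ξ : ℝ) : ℂ) * A ξ
    + Complex.I * (ξ : ℂ) * Iinf (w ξ)
    - Complex.I * (ξ : ℂ) * ((|ξ| : ℝ) : ℂ) * A ξ
    - Complex.I * ∫ η : ℝ, A η * ((ξ - η : ℝ) : ℂ) * A (ξ - η)

/-- The forcing term `ℬ_ξ(w̄,A)(y)` in the rewritten form (2.15) of the paper, with
`∂_t A_ξ` replaced by `D_ξ`. -/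
def Bcal (ε t : ℝ) (w : ℝ → ℝ → ℂ) (A : ℝ → ℂ) (ξ y : ℝ) : ℂ :=
  A ξ * (((dtTheta ε t ξ y : ℝ) : ℂ) - ((deriv (deriv (theta ε t ξ)) y : ℝ) : ℂ))
    + ((theta ε t ξ y - 1 : ℝ) : ℂ) * Dbo ε t w A ξ
    + Complex.I * (ξ : ℂ) * (Iinf (w ξ) - Iy (w ξ) y)
    + Complex.I * (ξ : ℂ) * A ξ *
        (((y * (theta ε t ξ y - 1) - ∫ y' in Ioi y, (1 - theta ε t ξ y') : ℝ)) : ℂ)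
    + Complex.I * ∫ η : ℝ,
        (((ξ - η : ℝ) : ℂ) * A η * A (ξ - η) *
            ((theta ε t η y * theta ε t (ξ - η) y - 1 : ℝ) : ℂ)
          - (η : ℂ) * A η * A (ξ - η) * ((IyR (theta ε t η) y : ℝ) : ℂ) *
            ((deriv (theta ε t (ξ - η)) y : ℝ) : ℂ))


lemma kap_bd {ε t : ℝ} (hε : 0 < ε) (ht : 0 ≤ t) (hte : t ≤ ε) :
    1 ≤ 1 + t / ε ∧ 1 + t / ε ≤ 2 := by
  have h1 : 0 ≤ t / ε := by positivity
  have h2 : t / ε ≤ 1 := by rw [div_le_one hε]; exact hte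
  constructor <;> linarith

lemma rho_sq (ε t y : ℝ) : rho ε t y ^ 2 = Real.exp (y ^ 2 / (4 * (1 + t / ε))) := by
  unfold rho
  rw [← Real.exp_nat_mul]
  congr 1
  push_cast
  rw [show 8 * (1 + t / ε) = 2 * (4 * (1 + t / ε)) by ring, ← div_div]
  ring

/-- `x = y²b²/(4κ)`; the Gaussian `e_ξ ρ²  ≤ exp(-x)`. -/
lemma e_rho_le {ε t : ℝ} (hε : 0 < ε) (ht : 0 ≤ t) (hte : t ≤ ε) (ξ y : ℝ) :
    Real.exp (-(y ^ 2 * (1 + ξ ^ 2)) / (2 * (1 + t / ε))) * rho ε t y ^ 2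
      ≤ Real.exp (-(y ^ 2 * (1 + ξ ^ 2) / (4 * (1 + t / ε)))) := by
  obtain ⟨h1, h2⟩ := kap_bd hε ht hte
  rw [rho_sq, ← Real.exp_add]
  apply Real.exp_le_exp.mpr
  set k := 1 + t / ε
  have : -(y ^ 2 * (1 + ξ ^ 2)) / (2 * k) + y ^ 2 / (4 * k) - -(y ^ 2 * (1 + ξ ^ 2) / (4 * k))
    = - (y ^ 2 * ξ ^ 2 / (4 * k)) := by field_simp; ring
  have h3 : 0 ≤ y ^ 2 * ξ ^ 2 / (4 * k) := by positivity
  linarith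

lemma mul_exp_neg_le (x : ℝ) : x * Real.exp (-x) ≤ 1 := by
  have := Real.add_one_le_exp x
  rw [Real.exp_neg, ← div_eq_mul_inv, div_le_one (Real.exp_pos _)]
  linarith

lemma one_sub_theta (ε t ξ y : ℝ) : 1 - theta ε t ξ y =
    Real.exp (-(y ^ 2 * (1 + ξ ^ 2)) / (2 * (1 + t / ε))) := by
  unfold theta; ring

lemma one_sub_theta_rho {ε t : ℝ} (hε : 0 < ε) (ht : 0 ≤ t) (hte : t ≤ ε) (ξ y : ℝ) :
    (1 - theta ε t ξ y) * rho ε t y ^ 2 ≤ 1 := by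
  obtain ⟨h1, h2⟩ := kap_bd hε ht hte
  rw [one_sub_theta]
  refine (e_rho_le hε ht hte ξ y).trans ?_
  rw [Real.exp_le_one_iff]
  have : 0 ≤ (y ^ 2 * (1 + ξ ^ 2) / (4 * (1 + t / ε))) := by positivity
  linarith

lemma theta_mem {ε t : ℝ} (hε : 0 < ε) (ht : 0 ≤ t) (hte : t ≤ ε) (ξ y : ℝ) :
    0 ≤ theta ε t ξ y ∧ theta ε t ξ y ≤ 1 := by
  obtain ⟨h1, h2⟩ := kap_bd hε ht hte
  unfold theta
  constructor
  · rw [sub_nonneg, Real.exp_le_one_iff, neg_div]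
    have : 0 ≤ (y ^ 2 * (1 + ξ ^ 2) / (2 * (1 + t / ε))) := by positivity
    linarith
  · have := Real.exp_pos (-(y ^ 2 * (1 + ξ ^ 2)) / (2 * (1 + t / ε)))
    linarith

lemma theta_mul_rho {ε t : ℝ} (hε : 0 < ε) (ht : 0 ≤ t) (hte : t ≤ ε) (ξ η y : ℝ) :
    |theta ε t ξ y * theta ε t η y - 1| * rho ε t y ^ 2 ≤ 2 := by
  have a1 := theta_mem hε ht hte ξ y
  have a2 := theta_mem hε ht hte η y
  have b1 := one_sub_theta_rho hε ht hte ξ y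
  have b2 := one_sub_theta_rho hε ht hte η y
  have : |theta ε t ξ y * theta ε t η y - 1| ≤ (1 - theta ε t ξ y) + (1 - theta ε t η y) := by
    rw [abs_le]; constructor <;> nlinarith
  calc _ ≤ ((1 - theta ε t ξ y) + (1 - theta ε t η y)) * rho ε t y ^ 2 := by gcongr
    _ ≤ 2 := by linarith

lemma theta_deriv (ε t ξ : ℝ) : deriv (theta ε t ξ) = fun y =>
    (y * (1 + ξ ^ 2) / (1 + t / ε)) *
      Real.exp (-(y ^ 2 * (1 + ξ ^ 2)) / (2 * (1 + t / ε))) := by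
  funext y
  have h : HasDerivAt (theta ε t ξ) (-(Real.exp (-(y ^ 2 * (1 + ξ ^ 2)) / (2 * (1 + t / ε))) *
      (-((2 * y) * (1 + ξ ^ 2)) / (2 * (1 + t / ε))))) y := by
    unfold theta
    refine HasDerivAt.const_sub _ (HasDerivAt.exp (HasDerivAt.div_const (HasDerivAt.fun_neg
      (HasDerivAt.mul_const ?_ _)) _))
    simpa using hasDerivAt_pow 2 y
  rw [h.deriv]
  rw [show -((2 * y) * (1 + ξ ^ 2)) / (2 * (1 + t / ε)) = -(y * (1 + ξ ^ 2) / (1 + t / ε)) by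
    rw [show -((2 * y) * (1 + ξ ^ 2)) = 2 * (-(y * (1 + ξ ^ 2))) by ring,
      mul_div_mul_left _ _ two_ne_zero, neg_div]]
  ring

lemma theta_deriv2 (ε t ξ y : ℝ) : deriv (deriv (theta ε t ξ)) y =
    ((1 + ξ ^ 2) / (1 + t / ε)) * (1 - y ^ 2 * (1 + ξ ^ 2) / (1 + t / ε)) *
      Real.exp (-(y ^ 2 * (1 + ξ ^ 2)) / (2 * (1 + t / ε))) := by
  rw [theta_deriv]
  have h0 : HasDerivAt (fun y : ℝ => Real.exp (-(y ^ 2 * (1 + ξ ^ 2)) / (2 * (1 + t / ε))))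
      (Real.exp (-(y ^ 2 * (1 + ξ ^ 2)) / (2 * (1 + t / ε))) *
      (-((2 * y) * (1 + ξ ^ 2)) / (2 * (1 + t / ε)))) y := by
    refine (HasDerivAt.exp (HasDerivAt.div_const (HasDerivAt.fun_neg
      (HasDerivAt.mul_const ?_ _)) _))
    simpa using hasDerivAt_pow 2 y
  have h1 : HasDerivAt (fun y : ℝ => y * (1 + ξ ^ 2) / (1 + t / ε))
      (1 * (1 + ξ ^ 2) / (1 + t / ε)) y :=
    ((hasDerivAt_id y).mul_const _).div_const _
  rw [(h1.fun_mul h0).deriv]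
  rw [show -((2 * y) * (1 + ξ ^ 2)) / (2 * (1 + t / ε)) = -(y * (1 + ξ ^ 2) / (1 + t / ε)) by
    rw [show -((2 * y) * (1 + ξ ^ 2)) = 2 * (-(y * (1 + ξ ^ 2))) by ring,
      mul_div_mul_left _ _ two_ne_zero, neg_div]]
  ring

lemma theta_deriv2_rho {ε t : ℝ} (hε : 0 < ε) (ht : 0 ≤ t) (hte : t ≤ ε) (ξ y : ℝ) :
    |deriv (deriv (theta ε t ξ)) y| * rho ε t y ^ 2
      ≤ 8 * (1 + ξ ^ 2) * Real.exp (-(y ^ 2 * (1 + ξ ^ 2) / 16)) := by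
  obtain ⟨h1, h2⟩ := kap_bd hε ht hte
  rw [theta_deriv2, abs_mul, Real.abs_exp, mul_assoc]
  have h3 := e_rho_le hε ht hte ξ y
  set k := 1 + t / ε
  set x := y ^ 2 * (1 + ξ ^ 2) / (4 * k) with hx
  have hx0 : 0 ≤ x := by positivity
  have h4 : |(1 + ξ ^ 2) / k * (1 - y ^ 2 * (1 + ξ ^ 2) / k)| ≤ (1 + ξ ^ 2) * (1 + 4 * x) := by
    rw [abs_mul]
    gcongr
    · rw [abs_of_nonneg (by positivity)]
      exact div_le_self (by positivity) h1
    · have : y ^ 2 * (1 + ξ ^ 2) / k = 4 * x := by rw [hx]; field_simp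
      rw [this, abs_le]; constructor <;> linarith
  have h5 : (1 + 4 * x) * Real.exp (-x) ≤ 8 * Real.exp (-(x / 2)) := by
    have : 1 + 4 * x ≤ 8 * Real.exp (x / 2) := by
      have := Real.add_one_le_exp (x / 2); linarith
    calc _ ≤ 8 * Real.exp (x / 2) * Real.exp (-x) := by gcongr
      _ = 8 * Real.exp (-(x / 2)) := by
        rw [mul_assoc, ← Real.exp_add]; congr 2; ring
  have h6 : Real.exp (-(x / 2)) ≤ Real.exp (-(y ^ 2 * (1 + ξ ^ 2) / 16)) := by
    apply Real.exp_le_exp.mpr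
    have : y ^ 2 * (1 + ξ ^ 2) / 16 ≤ x / 2 := by
      rw [hx, div_div]
      apply div_le_div_of_nonneg_left (by positivity) (by positivity)
      linarith
    linarith
  calc _ ≤ ((1 + ξ ^ 2) * (1 + 4 * x)) * Real.exp (-x) := by gcongr
    _ = (1 + ξ ^ 2) * ((1 + 4 * x) * Real.exp (-x)) := by ring
    _ ≤ (1 + ξ ^ 2) * (8 * Real.exp (-(y ^ 2 * (1 + ξ ^ 2) / 16))) := by
      gcongr ?_ * ?_; linarith
    _ = _ := by ring

lemma xi_sq_rho {ε t : ℝ} (hε : 0 < ε) (ht : 0 ≤ t) (hte : t ≤ ε) (ξ y : ℝ) :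
    (1 - theta ε t ξ y) * (|ξ| * |ξ|) * rho ε t y ^ 2
      ≤ (1 + ξ ^ 2) * Real.exp (-(y ^ 2 * (1 + ξ ^ 2) / 16)) := by
  obtain ⟨h1, h2⟩ := kap_bd hε ht hte
  rw [one_sub_theta]
  have h3 := e_rho_le hε ht hte ξ y
  set k := 1 + t / ε
  have h6 : Real.exp (-(y ^ 2 * (1 + ξ ^ 2) / (4 * k))) ≤ Real.exp (-(y ^ 2 * (1 + ξ ^ 2) / 16)) := by
    apply Real.exp_le_exp.mpr
    have : y ^ 2 * (1 + ξ ^ 2) / 16 ≤ y ^ 2 * (1 + ξ ^ 2) / (4 * k) := by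
      apply div_le_div_of_nonneg_left (by positivity) (by positivity)
      linarith
    linarith
  have h7 : |ξ| * |ξ| = ξ ^ 2 := by rw [abs_mul_abs_self]; ring
  calc _ = ξ ^ 2 * (Real.exp (-(y ^ 2 * (1 + ξ ^ 2)) / (2 * k)) * rho ε t y ^ 2) := by
        rw [h7]; ring
    _ ≤ (1 + ξ ^ 2) * Real.exp (-(y ^ 2 * (1 + ξ ^ 2) / 16)) := by
      gcongr
      · linarith
      · linarith

lemma dtTheta_rho {ε t : ℝ} (hε : 0 < ε) (ht : 0 ≤ t) (hte : t ≤ ε) (ξ y : ℝ) :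
    |dtTheta ε t ξ y| * rho ε t y ^ 2 ≤ 2 * ε⁻¹ := by
  obtain ⟨h1, h2⟩ := kap_bd hε ht hte
  have h3 := e_rho_le hε ht hte ξ y
  unfold dtTheta
  set k := 1 + t / ε
  set x := y ^ 2 * (1 + ξ ^ 2) / (4 * k) with hx
  have hx0 : 0 ≤ x := by positivity
  rw [abs_mul, Real.abs_exp, mul_assoc, abs_neg, abs_of_nonneg (by positivity)]
  have h4 : y ^ 2 * (1 + ξ ^ 2) / (2 * ε * k ^ 2) ≤ 2 * ε⁻¹ * x := by
    have : y ^ 2 * (1 + ξ ^ 2) / (2 * ε * k ^ 2) = (2 * ε⁻¹ * x) / k := by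
      rw [hx]; field_simp; norm_num
    rw [this]
    exact div_le_self (by positivity) h1
  calc _ ≤ (2 * ε⁻¹ * x) * Real.exp (-x) := by gcongr
    _ = 2 * ε⁻¹ * (x * Real.exp (-x)) := by ring
    _ ≤ 2 * ε⁻¹ * 1 := by gcongr; exact mul_exp_neg_le x
    _ = _ := by ring

lemma theta_cont (ε t ξ : ℝ) : Continuous (theta ε t ξ) := by
  unfold theta; fun_prop

lemma IyR_le {ε t : ℝ} (hε : 0 < ε) (ht : 0 ≤ t) (hte : t ≤ ε) (η : ℝ) {y : ℝ} (hy : 0 < y) :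
    |IyR (theta ε t η) y| ≤ y := by
  unfold IyR
  have := intervalIntegral.norm_integral_le_of_norm_le_const (a := 0) (b := y) (C := 1)
    (f := theta ε t η) (fun x _ => by
      have := theta_mem hε ht hte η x
      rw [Real.norm_eq_abs, abs_of_nonneg this.1]; exact this.2)
  simpa [abs_of_pos hy] using this

lemma IyR_deriv_rho {ε t : ℝ} (hε : 0 < ε) (ht : 0 ≤ t) (hte : t ≤ ε) (η ζ : ℝ) {y : ℝ}
    (hy : 0 < y) :
    |IyR (theta ε t η) y| * |deriv (theta ε t ζ) y| * rho ε t y ^ 2 ≤ 4 := by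
  obtain ⟨h1, h2⟩ := kap_bd hε ht hte
  have h3 := e_rho_le hε ht hte ζ y
  have h4 := IyR_le hε ht hte η hy
  rw [theta_deriv]
  simp only
  set k := 1 + t / ε
  set x := y ^ 2 * (1 + ζ ^ 2) / (4 * k) with hx
  have hx0 : 0 ≤ x := by positivity
  rw [abs_mul, Real.abs_exp, abs_of_nonneg (by positivity : 0 ≤ y * (1 + ζ ^ 2) / k)]
  calc _ ≤ y * (y * (1 + ζ ^ 2) / k * Real.exp (-(y ^ 2 * (1 + ζ ^ 2)) / (2 * k))) *
        rho ε t y ^ 2 := by gcongr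
    _ = 4 * x * (Real.exp (-(y ^ 2 * (1 + ζ ^ 2)) / (2 * k)) * rho ε t y ^ 2) := by
      rw [hx]; field_simp
    _ ≤ 4 * x * Real.exp (-x) := by gcongr
    _ = 4 * (x * Real.exp (-x)) := by ring
    _ ≤ 4 * 1 := by gcongr; exact mul_exp_neg_le x
    _ = _ := by ring

lemma brak_pos (ξ : ℝ) : 0 < brak ξ := by unfold brak; positivity
lemma one_le_brak (ξ : ℝ) : 1 ≤ brak ξ := by
  unfold brak; rw [Real.one_le_sqrt]; nlinarith [sq_nonneg ξ]
lemma abs_le_brak (ξ : ℝ) : |ξ| ≤ brak ξ := by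
  unfold brak; apply Real.abs_le_sqrt; linarith
lemma brak_sq (ξ : ℝ) : brak ξ ^ 2 = 1 + ξ ^ 2 := by
  unfold brak; rw [Real.sq_sqrt]; positivity

lemma xi_cTheta {ε t : ℝ} (hε : 0 < ε) (ht : 0 ≤ t) (hte : t ≤ ε) (ξ : ℝ) :
    |ξ| * |cTheta ε t ξ| ≤ 2 := by
  obtain ⟨h1, h2⟩ := kap_bd hε ht hte
  unfold cTheta
  have hb := brak_pos ξ
  rw [abs_of_nonneg (by positivity : 0 ≤ √(Real.pi * (1 + t / ε)) / (2 * brak ξ)), ← mul_div_assoc,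
    div_le_iff₀ (by positivity)]
  have : √(Real.pi * (1 + t / ε)) ≤ 4 := by
    rw [Real.sqrt_le_left (by norm_num)]
    nlinarith [Real.pi_le_four, Real.pi_pos]
  calc _ ≤ brak ξ * 4 := by gcongr; exact abs_le_brak ξ
    _ = _ := by ring

lemma tail_rho {ε t : ℝ} (hε : 0 < ε) (ht : 0 ≤ t) (hte : t ≤ ε) (ξ : ℝ) {y : ℝ} (hy : 0 < y) :
    |ξ| * |y * (theta ε t ξ y - 1) - ∫ y' in Ioi y, (1 - theta ε t ξ y')| * rho ε t y ^ 2 ≤ 4 := by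
  obtain ⟨h1, h2⟩ := kap_bd hε ht hte
  have hb := brak_pos ξ
  have hbs := brak_sq ξ
  have hxb := abs_le_brak ξ
  have h3 := e_rho_le hε ht hte ξ y
  set k := 1 + t / ε with hk
  set b := brak ξ with hbdef
  set e := 1 - theta ε t ξ y with he
  have heq : e = Real.exp (-(y ^ 2 * (1 + ξ ^ 2)) / (2 * k)) := one_sub_theta _ _ _ _
  have he0 : 0 ≤ e := by rw [heq]; positivity
  have hcoef : 0 < b ^ 2 / (2 * k) := by positivity
  have hfun : (fun s : ℝ => 1 - theta ε t ξ s) = fun s => Real.exp (-(b ^ 2 / (2 * k)) * s ^ 2) := by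
    funext s; rw [one_sub_theta, hbs]; congr 1; ring
  have hint0 : Integrable (fun s : ℝ => 1 - theta ε t ξ s) := by
    rw [hfun]; exact integrable_exp_neg_mul_sq hcoef
  have hI0 : ∫ s in Ioi (0:ℝ), (1 - theta ε t ξ s) ≤ 2 / b := by
    rw [hfun, integral_gaussian_Ioi]
    have : √(Real.pi / (b ^ 2 / (2 * k))) ≤ 4 / b := by
      rw [Real.sqrt_le_left (by positivity), div_pow, div_div_eq_mul_div]
      gcongr
      nlinarith [Real.pi_le_four, Real.pi_pos]
    calc _ ≤ (4 / b) / 2 := by gcongr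
      _ = _ := by ring
  have htail : ∫ s in Ioi y, (1 - theta ε t ξ s) ≤ e * (2 / b) := by
    have hsh : ∫ s in Ioi y, (1 - theta ε t ξ s) = ∫ s in Ioi (0:ℝ), (1 - theta ε t ξ (s + y)) := by
      rw [← (measurePreserving_add_right volume y).setIntegral_preimage_emb
        (measurableEmbedding_addRight y) (fun s => 1 - theta ε t ξ s) (Ioi y)]
      simp
    rw [hsh]
    calc _ ≤ ∫ s in Ioi (0:ℝ), e * (1 - theta ε t ξ s) := by
          apply setIntegral_mono_on
          · exact (hint0.comp_add_right y).integrableOn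
          · exact (hint0.const_mul e).integrableOn
          · exact measurableSet_Ioi
          · intro s hs
            have hs : 0 < s := hs
            rw [heq, one_sub_theta, one_sub_theta, ← Real.exp_add]
            apply Real.exp_le_exp.mpr
            rw [← add_div]
            gcongr
            nlinarith [mul_pos (mul_pos hs hy) (by positivity : 0 < 1 + ξ ^ 2)]
      _ = e * ∫ s in Ioi (0:ℝ), (1 - theta ε t ξ s) := integral_const_mul _ _
      _ ≤ _ := by gcongr
  have htail0 : 0 ≤ ∫ s in Ioi y, (1 - theta ε t ξ s) :=
    integral_nonneg fun s => by rw [one_sub_theta]; positivity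
  have hA : |y * (theta ε t ξ y - 1) - ∫ y' in Ioi y, (1 - theta ε t ξ y')| ≤ y * e + e * (2 / b) := by
    have : y * (theta ε t ξ y - 1) = - (y * e) := by rw [he]; ring
    rw [this, abs_le]
    have : 0 ≤ y * e := by positivity
    constructor <;> linarith
  have hG := one_sub_theta_rho hε ht hte ξ y
  have hP : b * y * (e * rho ε t y ^ 2) ≤ 2 := by
    rw [heq]
    set z := b * y with hz
    have hz0 : 0 < z := by positivity
    calc _ ≤ z * Real.exp (-(y ^ 2 * (1 + ξ ^ 2) / (4 * k))) := by gcongr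
      _ ≤ z * Real.exp (-(z ^ 2 / 8)) := by
        gcongr
        rw [← hbs, hz, mul_pow, mul_comm (y ^ 2)]
        linarith
      _ ≤ 2 := by
        have := Real.add_one_le_exp (z ^ 2 / 8)
        rw [Real.exp_neg, ← div_eq_mul_inv, div_le_iff₀ (Real.exp_pos _)]
        nlinarith [sq_nonneg (z - 2)]
  calc _ ≤ b * (y * e + e * (2 / b)) * rho ε t y ^ 2 := by gcongr
    _ = b * y * (e * rho ε t y ^ 2) + 2 * (e * rho ε t y ^ 2) := by field_simp
    _ ≤ 2 + 2 * 1 := by gcongr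
    _ = 4 := by norm_num


lemma cs_lint {α : Type*} [MeasurableSpace α] (μ : Measure α) {f g : α → ENNReal}
    (hf : AEMeasurable f μ) (hg : AEMeasurable g μ) :
    ∫⁻ a, f a * g a ∂μ ≤ (∫⁻ a, f a ^ 2 ∂μ) ^ (1 / 2 : ℝ) * (∫⁻ a, g a ^ 2 ∂μ) ^ (1 / 2 : ℝ) := by
  have := ENNReal.lintegral_mul_le_Lp_mul_Lq μ Real.HolderConjugate.two_two hf hg
  simpa using this

lemma sqrt_sq_enn (x : ENNReal) : (x ^ (1 / 2 : ℝ)) ^ 2 = x := by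
  rw [← ENNReal.rpow_natCast, ← ENNReal.rpow_mul]; norm_num

lemma sq_sqrt_enn (x : ENNReal) : (x ^ 2) ^ (1 / 2 : ℝ) = x := by
  rw [← ENNReal.rpow_natCast, ← ENNReal.rpow_mul]; norm_num

lemma mul_le_sq_add (x y : ENNReal) : x * y ≤ x ^ 2 + y ^ 2 := by
  rcases le_total x y with h | h
  · calc x * y ≤ y * y := by gcongr
      _ = y ^ 2 := by ring
      _ ≤ _ := le_add_self
  · calc x * y ≤ x * x := by gcongr
      _ = x ^ 2 := by ring
      _ ≤ _ := le_self_add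

/-- slice norm -/
def sl (ε t : ℝ) (f : ℝ → ℂ) : ENNReal :=
  (∫⁻ y in Ioi (0:ℝ), (‖f y‖ₑ * ENNReal.ofReal (rho ε t y)) ^ 2) ^ (1 / 2 : ℝ)

lemma rho_pos (ε t y : ℝ) : 0 < rho ε t y := Real.exp_pos _

lemma rho_cont (ε t : ℝ) : Continuous (rho ε t) := by unfold rho; fun_prop

lemma lint_gauss {c : ℝ} (hc : 0 < c) :
    ∫⁻ y in Ioi (0:ℝ), ENNReal.ofReal (Real.exp (-c * y ^ 2)) = ENNReal.ofReal (√(Real.pi / c) / 2) := by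
  rw [← integral_gaussian_Ioi, ofReal_integral_eq_lintegral_ofReal]
  · exact (integrable_exp_neg_mul_sq hc).integrableOn
  · exact Eventually.of_forall fun y => (Real.exp_pos _).le

lemma lint_gauss_full {c : ℝ} (hc : 0 < c) :
    ∫⁻ y : ℝ, ENNReal.ofReal (Real.exp (-c * y ^ 2)) = ENNReal.ofReal (√(Real.pi / c)) := by
  rw [← integral_gaussian, ofReal_integral_eq_lintegral_ofReal]
  · exact (integrable_exp_neg_mul_sq hc)
  · exact Eventually.of_forall fun y => (Real.exp_pos _).le

lemma J_le {ε t : ℝ} (hε : 0 < ε) (ht : 0 ≤ t) (hte : t ≤ ε) {w : ℝ → ℂ}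
    (hw : AEMeasurable w (volume.restrict (Ioi 0))) :
    ∫⁻ y in Ioi (0:ℝ), ‖w y‖ₑ ≤ 3 * sl ε t w := by
  obtain ⟨h1, h2⟩ := kap_bd hε ht hte
  have hr := rho_cont ε t
  have e1 : ∀ y, ‖w y‖ₑ = (‖w y‖ₑ * ENNReal.ofReal (rho ε t y)) * ENNReal.ofReal ((rho ε t y)⁻¹) := by
    intro y
    rw [mul_assoc, ← ENNReal.ofReal_mul (rho_pos _ _ _).le, mul_inv_cancel₀ (rho_pos _ _ _).ne']
    simp
  calc _ = ∫⁻ y in Ioi (0:ℝ), (‖w y‖ₑ * ENNReal.ofReal (rho ε t y)) *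
        ENNReal.ofReal ((rho ε t y)⁻¹) := lintegral_congr e1
    _ ≤ _ := cs_lint _ (hw.enorm.mul (by fun_prop)) (by
        apply Measurable.aemeasurable
        have := hr.measurable
        fun_prop)
    _ ≤ sl ε t w * 3 := by
      unfold sl
      gcongr
      have : ∀ y, ENNReal.ofReal ((rho ε t y)⁻¹) ^ 2
          = ENNReal.ofReal (Real.exp (-(1 / (4 * (1 + t / ε))) * y ^ 2)) := by
        intro y
        rw [← ENNReal.ofReal_pow (by have := rho_pos ε t y; positivity), inv_pow, rho_sq,
          ← Real.exp_neg]
        congr 2; ring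
      simp_rw [this]
      rw [lint_gauss (by positivity)]
      calc _ ≤ ((3:ENNReal) ^ 2) ^ (1 / 2 : ℝ) := by
            gcongr
            rw [show (3:ENNReal) ^ 2 = ENNReal.ofReal 9 by norm_num]
            apply ENNReal.ofReal_le_ofReal
            have : √(Real.pi / (1 / (4 * (1 + t / ε)))) ≤ 18 := by
              rw [Real.sqrt_le_left (by norm_num), one_div, div_inv_eq_mul]
              nlinarith [Real.pi_le_four, Real.pi_pos]
            linarith
        _ = 3 := sq_sqrt_enn _
    _ = _ := mul_comm _ _

lemma conv_le {ε t : ℝ} (hε : 0 < ε) (ht : 0 ≤ t) (hte : t ≤ ε) {w : ℝ → ℂ}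
    (hw : AEMeasurable w (volume.restrict (Ioi 0))) :
    ∫⁻ y in Ioi (0:ℝ), (∫⁻ z in Ioi y, ‖w z‖ₑ) * (‖w y‖ₑ * ENNReal.ofReal (rho ε t y ^ 2))
      ≤ 16 * sl ε t w ^ 2 := by
  obtain ⟨h1, h2⟩ := kap_bd hε ht hte
  have hr := rho_cont ε t
  set f : ℝ → ENNReal := fun y => ‖w y‖ₑ * ENNReal.ofReal (rho ε t y) with hf
  have hfm : AEMeasurable f (volume.restrict (Ioi 0)) := hw.enorm.mul (by fun_prop)
  set K : ℝ → ENNReal := fun s => ENNReal.ofReal (Real.exp (-(1/16) * s ^ 2)) with hK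
  have hKm : Measurable K := by fun_prop
  have hKi : ∫⁻ s, K s ≤ 8 := by
    rw [hK, lint_gauss_full (by norm_num)]
    rw [show (8:ENNReal) = ENNReal.ofReal 8 by norm_num]
    apply ENNReal.ofReal_le_ofReal
    rw [Real.sqrt_le_left (by norm_num)]
    nlinarith [Real.pi_le_four, Real.pi_pos]
  calc _ ≤ ∫⁻ y in Ioi (0:ℝ), ∫⁻ z in Ioi (0:ℝ), (f y ^ 2 * K (z - y) + f z ^ 2 * K (z - y)) := by
        apply setLIntegral_mono' measurableSet_Ioi
        intro y hy
        have hy : 0 < y := hy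
        rw [← lintegral_mul_const' _ _ (by
          exact ENNReal.mul_ne_top enorm_ne_top ENNReal.ofReal_ne_top)]
        calc _ ≤ ∫⁻ z in Ioi y, (f y ^ 2 * K (z - y) + f z ^ 2 * K (z - y)) := by
              apply setLIntegral_mono' measurableSet_Ioi
              intro z hz
              have hz : y < z := hz
              rw [← add_mul]
              calc _ ≤ f y * f z * K (z - y) := by
                    simp only [hf, hK]
                    have : ENNReal.ofReal (rho ε t y ^ 2) ≤ ENNReal.ofReal (rho ε t y) *
                      ENNReal.ofReal (rho ε t z) * ENNReal.ofReal (Real.exp (-(1/16) * (z - y) ^ 2)) := by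
                      rw [← ENNReal.ofReal_mul (rho_pos _ _ _).le, ← ENNReal.ofReal_mul
                        (mul_nonneg (rho_pos _ _ _).le (rho_pos _ _ _).le)]
                      apply ENNReal.ofReal_le_ofReal
                      rw [sq, mul_assoc]
                      have := rho_pos ε t y
                      gcongr
                      unfold rho
                      rw [← Real.exp_add]
                      apply Real.exp_le_exp.mpr
                      have : (1/16) * (z - y) ^ 2 ≤ (z ^ 2 - y ^ 2) / (8 * (1 + t / ε)) := by
                        calc (1/16) * (z - y) ^ 2 = (z - y) ^ 2 / 16 := by ring
                          _ ≤ (z ^ 2 - y ^ 2) / (8 * (1 + t / ε)) := by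
                            gcongr
                            · nlinarith
                            · nlinarith
                            · linarith
                      rw [sub_div] at this
                      linarith
                    calc _ ≤ ‖w z‖ₑ * (‖w y‖ₑ * (ENNReal.ofReal (rho ε t y) *
                      ENNReal.ofReal (rho ε t z) * ENNReal.ofReal (Real.exp (-(1/16) * (z - y) ^ 2)))) := by
                          gcongr
                      _ = _ := by ring
                _ ≤ _ := by gcongr; exact mul_le_sq_add _ _
          _ ≤ _ := lintegral_mono_set (Ioi_subset_Ioi hy.le)
    _ = (∫⁻ y in Ioi (0:ℝ), f y ^ 2 * ∫⁻ z in Ioi (0:ℝ), K (z - y)) +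
        ∫⁻ y in Ioi (0:ℝ), ∫⁻ z in Ioi (0:ℝ), f z ^ 2 * K (z - y) := by
        rw [← lintegral_add_left']
        · apply lintegral_congr
          intro y
          rw [lintegral_add_left (by fun_prop), lintegral_const_mul _ (by fun_prop)]
        · apply (hfm.pow_const 2).mul
          apply Measurable.aemeasurable
          exact Measurable.lintegral_prod_right' (f := fun p : ℝ × ℝ => K (p.2 - p.1)) (by fun_prop)
    _ = (∫⁻ y in Ioi (0:ℝ), f y ^ 2 * ∫⁻ z in Ioi (0:ℝ), K (z - y)) +
        ∫⁻ z in Ioi (0:ℝ), f z ^ 2 * ∫⁻ y in Ioi (0:ℝ), K (z - y) := by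
        congr 1
        rw [lintegral_lintegral_swap]
        · apply lintegral_congr
          intro z
          rw [lintegral_const_mul _ (by fun_prop)]
        · exact AEMeasurable.mul (f := fun p : ℝ × ℝ => f p.2 ^ 2) (g := fun p => K (p.2 - p.1))
            (hfm.pow_const 2).comp_snd (Measurable.aemeasurable (by fun_prop))
    _ ≤ (∫⁻ y in Ioi (0:ℝ), f y ^ 2 * 8) + ∫⁻ z in Ioi (0:ℝ), f z ^ 2 * 8 := by
        gcongr with y z
        · refine (setLIntegral_le_lintegral _ _).trans ?_
          rw [lintegral_sub_right_eq_self K y]; exact hKi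
        · refine (setLIntegral_le_lintegral _ _).trans ?_
          rw [lintegral_sub_left_eq_self K z]; exact hKi
    _ = 16 * sl ε t w ^ 2 := by
        rw [lintegral_mul_const' _ _ (by norm_num), sl, sqrt_sq_enn]
        ring

lemma w_le {ε t : ℝ} {w : ℝ → ℂ} (hε : 0 < ε) (ht : 0 ≤ t)
    (hw : ContDiffOn ℝ 1 w (Ici 0)) (h0 : w 0 = 0) {y : ℝ} (hy : 0 < y) :
    ‖w y‖ₑ ≤ ENNReal.ofReal (√y) * sl ε t (deriv w) := by
  have hk : 0 < 1 + t / ε := by positivity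
  have hd : ContinuousOn (derivWithin w (Ici 0)) (Ici 0) :=
    hw.continuousOn_derivWithin (uniqueDiffOn_Ici 0) le_rfl
  have heq : ∀ x ∈ Ioo 0 y, HasDerivAt w (derivWithin w (Ici 0) x) x := by
    intro x hx
    have := ((hw.differentiableOn one_ne_zero) x hx.1.le).hasDerivWithinAt
    exact this.hasDerivAt (Ici_mem_nhds hx.1)
  have hI := intervalIntegral.integral_eq_sub_of_hasDerivAt_of_le hy.le
    (hw.continuousOn.mono (Icc_subset_Ici_self)) heq
    (ContinuousOn.intervalIntegrable (by rw [uIcc_of_le hy.le]; exact hd.mono Icc_subset_Ici_self))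
  rw [h0, sub_zero, intervalIntegral.integral_of_le hy.le, integral_Ioc_eq_integral_Ioo] at hI
  rw [← hI]
  calc _ ≤ ∫⁻ x in Ioo 0 y, ‖derivWithin w (Ici 0) x‖ₑ := enorm_integral_le_lintegral_enorm _
    _ = ∫⁻ x in Ioo 0 y, 1 * ‖deriv w x‖ₑ := by
      apply setLIntegral_congr_fun measurableSet_Ioo
      intro x hx
      simp only
      rw [(heq x hx).deriv, one_mul]
    _ ≤ _ := cs_lint _ (by fun_prop) (measurable_deriv w).enorm.aemeasurable
    _ ≤ _ := by
      unfold sl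
      gcongr ?_ * ?_
      · simp only [one_pow, lintegral_const, one_mul, Measure.restrict_apply MeasurableSet.univ,
          univ_inter, Real.volume_Ioo, sub_zero]
        rw [ENNReal.ofReal_rpow_of_nonneg hy.le (by norm_num), Real.sqrt_eq_rpow]
      · apply ENNReal.rpow_le_rpow _ (by norm_num)
        calc _ ≤ ∫⁻ x in Ioo 0 y, (‖deriv w x‖ₑ * ENNReal.ofReal (rho ε t x)) ^ 2 := by
              apply lintegral_mono
              intro x
              simp only
              gcongr
              calc ‖deriv w x‖ₑ = ‖deriv w x‖ₑ * 1 := (mul_one _).symm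
                _ ≤ _ := by
                  gcongr
                  rw [ENNReal.one_le_ofReal]
                  unfold rho
                  apply Real.one_le_exp
                  positivity
          _ ≤ _ := lintegral_mono_set Ioo_subset_Ioi_self

lemma gauss_w_le {ε t : ℝ} {w : ℝ → ℂ} (hε : 0 < ε) (ht : 0 ≤ t)
    (hw : ContDiffOn ℝ 1 w (Ici 0)) (h0 : w 0 = 0) (ξ : ℝ) :
    ∫⁻ y in Ioi (0:ℝ), ENNReal.ofReal ((1 + ξ ^ 2) * Real.exp (-(y ^ 2 * (1 + ξ ^ 2) / 16))) * ‖w y‖ₑ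
      ≤ 24 * ENNReal.ofReal (√(brak ξ)) * sl ε t (deriv w) := by
  have hb := brak_pos ξ
  rw [← brak_sq]
  set b := brak ξ
  calc _ ≤ ∫⁻ y in Ioi (0:ℝ), (ENNReal.ofReal (4 * b * √b) * sl ε t (deriv w)) *
        ENNReal.ofReal (Real.exp (-(b ^ 2 / 32) * y ^ 2)) := by
        apply setLIntegral_mono' measurableSet_Ioi
        intro y hy
        have hy : 0 < y := hy
        calc _ ≤ ENNReal.ofReal (b ^ 2 * Real.exp (-(y ^ 2 * b ^ 2 / 16))) *
              (ENNReal.ofReal (√y) * sl ε t (deriv w)) := by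
                gcongr; exact w_le hε ht hw h0 hy
          _ = ENNReal.ofReal (b ^ 2 * Real.exp (-(y ^ 2 * b ^ 2 / 16)) * √y) * sl ε t (deriv w) := by
                rw [← mul_assoc, ← ENNReal.ofReal_mul (by positivity)]
          _ ≤ ENNReal.ofReal (4 * b * √b * Real.exp (-(b ^ 2 / 32) * y ^ 2)) * sl ε t (deriv w) := by
                refine mul_le_mul_left (ENNReal.ofReal_le_ofReal ?_) _
                set x := b * y with hx
                have hx0 : 0 < x := by positivity
                have e1 : √b * √y = √x := (Real.sqrt_mul hb.le _).symm
                have e2 : √x ≤ 4 * Real.exp (x ^ 2 / 32) := by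
                  have a1 := Real.add_one_le_exp (x ^ 2 / 32)
                  have a2 : √x ≤ (1 + x) / 2 := by
                    nlinarith [sq_nonneg (√x - 1), Real.sq_sqrt hx0.le]
                  nlinarith [sq_nonneg (x - 2)]
                have e3 : √b * √b = b := Real.mul_self_sqrt hb.le
                calc b ^ 2 * Real.exp (-(y ^ 2 * b ^ 2 / 16)) * √y
                    = b * √b * (√b * √y) * Real.exp (-(y ^ 2 * b ^ 2 / 16)) := by
                      linear_combination (-(b * √y * Real.exp (-(y ^ 2 * b ^ 2 / 16)))) * e3
                  _ ≤ b * √b * (4 * Real.exp (x ^ 2 / 32)) * Real.exp (-(y ^ 2 * b ^ 2 / 16)) := by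
                      rw [e1]; gcongr
                  _ = 4 * b * √b * (Real.exp (x ^ 2 / 32) * Real.exp (-(y ^ 2 * b ^ 2 / 16))) := by ring
                  _ = _ := by
                      rw [← Real.exp_add, hx]; congr 2; ring
          _ = _ := by rw [ENNReal.ofReal_mul (by positivity)]; ring
    _ = (ENNReal.ofReal (4 * b * √b) * sl ε t (deriv w)) *
        ENNReal.ofReal (√(Real.pi / (b ^ 2 / 32)) / 2) := by
        rw [lintegral_const_mul _ (by fun_prop), lint_gauss (by positivity)]
    _ ≤ (ENNReal.ofReal (4 * b * √b) * sl ε t (deriv w)) * ENNReal.ofReal (6 / b) := by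
        refine mul_le_mul_right (ENNReal.ofReal_le_ofReal ?_) _
        have : √(Real.pi / (b ^ 2 / 32)) ≤ 12 / b := by
          rw [Real.sqrt_le_left (by positivity), div_pow, div_div_eq_mul_div]
          gcongr
          nlinarith [Real.pi_le_four]
        calc _ ≤ 12 / b / 2 := by gcongr
          _ = _ := by ring
    _ = (ENNReal.ofReal (4 * b * √b) * ENNReal.ofReal (6 / b)) * sl ε t (deriv w) := by ring
    _ = _ := by
        congr 1
        rw [← ENNReal.ofReal_mul (by positivity), show 4 * b * √b * (6 / b) = 24 * √b by
          field_simp; norm_num, ENNReal.ofReal_mul (by norm_num)]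
        norm_num


lemma enr (x : ℝ) : ‖((x : ℝ) : ℂ)‖ₑ = ENNReal.ofReal |x| := by
  rw [← ofReal_norm, Complex.norm_real, Real.norm_eq_abs]

lemma enI : ‖Complex.I‖ₑ = 1 := by
  rw [← ofReal_norm, Complex.norm_I]; simp

def Qc (A : ℝ → ℂ) (ξ : ℝ) : ENNReal :=
  ∫⁻ η : ℝ, ‖A η‖ₑ * ENNReal.ofReal |ξ - η| * ‖A (ξ - η)‖ₑ

lemma Qc_symm (A : ℝ → ℂ) (ξ : ℝ) :
    ∫⁻ η : ℝ, ENNReal.ofReal |η| * ‖A η‖ₑ * ‖A (ξ - η)‖ₑ = Qc A ξ := by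
  unfold Qc
  rw [← lintegral_sub_left_eq_self _ ξ]
  apply lintegral_congr
  intro η
  rw [sub_sub_cancel]
  ring

lemma Dbo_le (ε t : ℝ) (w : ℝ → ℝ → ℂ) (A : ℝ → ℂ) (ξ : ℝ) :
    ‖Dbo ε t w A ξ‖ₑ ≤ ENNReal.ofReal (|ξ| * |cTheta ε t ξ|) * ‖A ξ‖ₑ
      + ENNReal.ofReal |ξ| * (∫⁻ y in Ioi (0:ℝ), ‖w ξ y‖ₑ)
      + ENNReal.ofReal (|ξ| * |ξ|) * ‖A ξ‖ₑ + Qc A ξ := by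
  unfold Dbo
  refine (enorm_sub_le).trans ?_
  gcongr
  · refine (enorm_sub_le).trans ?_
    gcongr
    · refine (enorm_add_le _ _).trans ?_
      gcongr
      · rw [enorm_mul, enorm_mul, enorm_mul, enorm_neg, enI, enr, enr, one_mul,
          ENNReal.ofReal_mul (abs_nonneg _)]
      · rw [enorm_mul, enorm_mul, enI, enr, one_mul]
        gcongr
        exact enorm_integral_le_lintegral_enorm _
    · rw [enorm_mul, enorm_mul, enorm_mul, enI, enr, enr, one_mul, abs_abs,
          ENNReal.ofReal_mul (abs_nonneg _)]
  · rw [enorm_mul, enI, one_mul]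
    refine (enorm_integral_le_lintegral_enorm _).trans ?_
    unfold Qc
    gcongr with η
    rw [enorm_mul, enorm_mul, enr]

lemma add5_mul_le {a b c d e p A B C D E : ENNReal} (h1 : a * p ≤ A) (h2 : b * p ≤ B)
    (h3 : c * p ≤ C) (h4 : d * p ≤ D) (h5 : e * p ≤ E) :
    (a + b + c + d + e) * p ≤ A + B + C + D + E := by
  rw [add_mul, add_mul, add_mul, add_mul]; gcongr

lemma ofReal_mul_le {x p c : ℝ} (hx : 0 ≤ x) (h : x * p ≤ c) :
    ENNReal.ofReal x * ENNReal.ofReal p ≤ ENNReal.ofReal c := by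
  rw [← ENNReal.ofReal_mul hx]; exact ENNReal.ofReal_le_ofReal h

lemma B_pt {ε t : ℝ} (hε : 0 < ε) (hε1 : ε ≤ 1) (ht : 0 ≤ t) (hte : t ≤ ε)
    (w : ℝ → ℝ → ℂ) (A : ℝ → ℂ) (hA : AEMeasurable (fun ξ => ‖A ξ‖ₑ))
    (ξ : ℝ) (hw : IntegrableOn (w ξ) (Ioi 0)) {y : ℝ} (hy : 0 < y) :
    ‖Bcal ε t w A ξ y‖ₑ * ENNReal.ofReal (rho ε t y ^ 2) ≤
      (ENNReal.ofReal (8 * ε⁻¹) * ‖A ξ‖ₑ + ENNReal.ofReal |ξ| * (∫⁻ y in Ioi (0:ℝ), ‖w ξ y‖ₑ)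
        + 7 * Qc A ξ)
      + 9 * ‖A ξ‖ₑ * ENNReal.ofReal ((1 + ξ ^ 2) * Real.exp (-(y ^ 2 * (1 + ξ ^ 2) / 16)))
      + ENNReal.ofReal |ξ| * ((∫⁻ z in Ioi y, ‖w ξ z‖ₑ) * ENNReal.ofReal (rho ε t y ^ 2)) := by
  have hinv : 1 ≤ ε⁻¹ := by rw [one_le_inv₀ hε]; exact hε1
  set p := rho ε t y ^ 2 with hp
  have hp0 : 0 ≤ p := by positivity
  set P := ENNReal.ofReal p with hP
  set G := ((1 + ξ ^ 2) * Real.exp (-(y ^ 2 * (1 + ξ ^ 2) / 16))) with hG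
  have hG0 : 0 ≤ G := by positivity
  set a := ‖A ξ‖ₑ with ha
  set J := (∫⁻ y in Ioi (0:ℝ), ‖w ξ y‖ₑ) with hJ
  set X := ENNReal.ofReal |ξ| with hX
  set Q := Qc A ξ with hQ
  have T1 : ‖A ξ * (((dtTheta ε t ξ y : ℝ) : ℂ) - ((deriv (deriv (theta ε t ξ)) y : ℝ) : ℂ))‖ₑ * P
      ≤ a * (ENNReal.ofReal (2 * ε⁻¹) + 8 * ENNReal.ofReal G) := by
    rw [enorm_mul, mul_assoc]
    gcongr
    calc _ ≤ (ENNReal.ofReal |dtTheta ε t ξ y| + ENNReal.ofReal |deriv (deriv (theta ε t ξ)) y|) * P := by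
          gcongr; rw [← enr, ← enr]; exact enorm_sub_le
      _ ≤ _ := by
        rw [add_mul]
        refine add_le_add ?_ ?_
        · exact ofReal_mul_le (abs_nonneg _) (dtTheta_rho hε ht hte ξ y)
        · refine (ofReal_mul_le (abs_nonneg _) (theta_deriv2_rho hε ht hte ξ y)).trans ?_
          rw [mul_assoc, ENNReal.ofReal_mul (by norm_num)]
          norm_num [hG]
  have T2 : ‖((theta ε t ξ y - 1 : ℝ) : ℂ) * Dbo ε t w A ξ‖ₑ * P
      ≤ ENNReal.ofReal (2 * ε⁻¹) * a + X * J + ENNReal.ofReal G * a + Q := by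
    have th := theta_mem hε ht hte ξ y
    have e0 : 0 ≤ 1 - theta ε t ξ y := by linarith
    have e1 : (1 - theta ε t ξ y) * p ≤ 1 := one_sub_theta_rho hε ht hte ξ y
    have E1 : ENNReal.ofReal (1 - theta ε t ξ y) * P ≤ 1 := by
      simpa using ofReal_mul_le e0 e1
    rw [enorm_mul, enr, abs_sub_comm, abs_of_nonneg e0]
    calc _ ≤ ENNReal.ofReal (1 - theta ε t ξ y) * (ENNReal.ofReal (|ξ| * |cTheta ε t ξ|) * a
          + X * J + ENNReal.ofReal (|ξ| * |ξ|) * a + Q) * P := by gcongr; exact Dbo_le ε t w A ξ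
      _ = (ENNReal.ofReal (1 - theta ε t ξ y) * P) * (ENNReal.ofReal (|ξ| * |cTheta ε t ξ|) * a)
          + (ENNReal.ofReal (1 - theta ε t ξ y) * P) * (X * J)
          + (ENNReal.ofReal (1 - theta ε t ξ y) * ENNReal.ofReal (|ξ| * |ξ|) * P) * a
          + (ENNReal.ofReal (1 - theta ε t ξ y) * P) * Q := by ring
      _ ≤ 1 * (ENNReal.ofReal (2 * ε⁻¹) * a) + 1 * (X * J) + ENNReal.ofReal G * a + 1 * Q := by
        refine add_le_add (add_le_add (add_le_add ?_ ?_) ?_) ?_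
        · refine mul_le_mul' E1 (mul_le_mul_left (ENNReal.ofReal_le_ofReal ?_) _)
          have := xi_cTheta hε ht hte ξ
          linarith
        · gcongr
        · refine mul_le_mul_left ?_ _
          rw [← ENNReal.ofReal_mul e0]
          exact ofReal_mul_le (by positivity) (xi_sq_rho hε ht hte ξ y)
        · gcongr
      _ = _ := by ring
  have T3 : ‖Complex.I * (ξ : ℂ) * (Iinf (w ξ) - Iy (w ξ) y)‖ₑ * P
      ≤ X * ((∫⁻ z in Ioi y, ‖w ξ z‖ₑ) * P) := by
    rw [enorm_mul, enorm_mul, enI, one_mul, enr, mul_assoc]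
    gcongr
    have : Iinf (w ξ) - Iy (w ξ) y = ∫ z in Ioi y, w ξ z := by
      unfold Iinf Iy
      rw [← intervalIntegral.integral_interval_add_Ioi hw (hw.mono_set (Ioi_subset_Ioi hy.le))]
      ring
    rw [this]
    exact enorm_integral_le_lintegral_enorm _
  have T4 : ‖Complex.I * (ξ : ℂ) * A ξ *
        (((y * (theta ε t ξ y - 1) - ∫ y' in Ioi y, (1 - theta ε t ξ y') : ℝ)) : ℂ)‖ₑ * P
      ≤ a * ENNReal.ofReal (4 * ε⁻¹) := by
    rw [enorm_mul, enorm_mul, enorm_mul, enI, one_mul, enr, enr]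
    have := ofReal_mul_le (by positivity) (tail_rho hε ht hte ξ hy)
    rw [ENNReal.ofReal_mul (abs_nonneg _)] at this
    calc _ = a * (ENNReal.ofReal |ξ| * ENNReal.ofReal |y * (theta ε t ξ y - 1) -
          ∫ y' in Ioi y, (1 - theta ε t ξ y')| * P) := by ring
      _ ≤ a * ENNReal.ofReal 4 := by gcongr
      _ ≤ _ := by gcongr; linarith
  have T5 : ‖Complex.I * ∫ η : ℝ,
        (((ξ - η : ℝ) : ℂ) * A η * A (ξ - η) *
            ((theta ε t η y * theta ε t (ξ - η) y - 1 : ℝ) : ℂ)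
          - (η : ℂ) * A η * A (ξ - η) * ((IyR (theta ε t η) y : ℝ) : ℂ) *
            ((deriv (theta ε t (ξ - η)) y : ℝ) : ℂ))‖ₑ * P ≤ 6 * Q := by
    rw [enorm_mul, enI, one_mul]
    calc _ ≤ (∫⁻ η : ℝ, ‖(((ξ - η : ℝ) : ℂ) * A η * A (ξ - η) *
            ((theta ε t η y * theta ε t (ξ - η) y - 1 : ℝ) : ℂ)
          - (η : ℂ) * A η * A (ξ - η) * ((IyR (theta ε t η) y : ℝ) : ℂ) *
            ((deriv (theta ε t (ξ - η)) y : ℝ) : ℂ))‖ₑ) * P := by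
          gcongr; exact enorm_integral_le_lintegral_enorm _
      _ = ∫⁻ η : ℝ, ‖(((ξ - η : ℝ) : ℂ) * A η * A (ξ - η) *
            ((theta ε t η y * theta ε t (ξ - η) y - 1 : ℝ) : ℂ)
          - (η : ℂ) * A η * A (ξ - η) * ((IyR (theta ε t η) y : ℝ) : ℂ) *
            ((deriv (theta ε t (ξ - η)) y : ℝ) : ℂ))‖ₑ * P := by
          rw [lintegral_mul_const' _ _ ENNReal.ofReal_ne_top]
      _ ≤ ∫⁻ η : ℝ, (2 * (‖A η‖ₑ * ENNReal.ofReal |ξ - η| * ‖A (ξ - η)‖ₑ) +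
            4 * (ENNReal.ofReal |η| * ‖A η‖ₑ * ‖A (ξ - η)‖ₑ)) := by
          apply lintegral_mono
          intro η
          have i1 := ofReal_mul_le (abs_nonneg _) (theta_mul_rho hε ht hte η (ξ - η) y)
          have i2 := ofReal_mul_le (by positivity) (IyR_deriv_rho hε ht hte η (ξ - η) hy)
          rw [ENNReal.ofReal_mul (abs_nonneg _)] at i2
          refine (mul_le_mul_left enorm_sub_le _).trans ?_
          rw [add_mul]
          simp only [enorm_mul, enr]
          refine add_le_add ?_ ?_
          · calc _ = (‖A η‖ₑ * ENNReal.ofReal |ξ - η| * ‖A (ξ - η)‖ₑ) *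
                  (ENNReal.ofReal |theta ε t η y * theta ε t (ξ - η) y - 1| * P) := by ring
              _ ≤ (‖A η‖ₑ * ENNReal.ofReal |ξ - η| * ‖A (ξ - η)‖ₑ) * ENNReal.ofReal 2 := by gcongr
              _ = _ := by rw [mul_comm]; norm_num
          · calc _ = (ENNReal.ofReal |η| * ‖A η‖ₑ * ‖A (ξ - η)‖ₑ) *
                  (ENNReal.ofReal |IyR (theta ε t η) y| *
                    ENNReal.ofReal |deriv (theta ε t (ξ - η)) y| * P) := by ring
              _ ≤ (ENNReal.ofReal |η| * ‖A η‖ₑ * ‖A (ξ - η)‖ₑ) * ENNReal.ofReal 4 := by gcongr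
              _ = _ := by rw [mul_comm]; norm_num
      _ = 2 * Q + 4 * Q := by
          have hA2 : AEMeasurable (fun η => ‖A (ξ - η)‖ₑ) :=
            hA.comp_quasiMeasurePreserving (quasiMeasurePreserving_sub_left volume ξ)
          rw [lintegral_add_left' (by fun_prop), lintegral_const_mul' _ _ (by norm_num),
            lintegral_const_mul' _ _ (by norm_num), Qc_symm]
          rfl
      _ = 6 * Q := by ring
  refine le_trans ?_ ((add5_mul_le T1 T2 T3 T4 T5).trans (le_of_eq ?_))
  · refine mul_le_mul_left ?_ _
    unfold Bcal
    exact (enorm_add_le _ _).trans (add_le_add_left ((enorm_add_le _ _).trans (add_le_add_left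
      ((enorm_add_le _ _).trans (add_le_add_left (enorm_add_le _ _) _)) _)) _)
  have : ENNReal.ofReal (8 * ε⁻¹) = ENNReal.ofReal (2 * ε⁻¹) + ENNReal.ofReal (2 * ε⁻¹)
      + ENNReal.ofReal (4 * ε⁻¹) := by
    rw [← ENNReal.ofReal_add (by positivity) (by positivity),
      ← ENNReal.ofReal_add (by positivity) (by positivity)]
    congr 1; ring
  rw [this]
  ring

lemma slice_le {ε t : ℝ} (hε : 0 < ε) (hε1 : ε ≤ 1) (ht : 0 ≤ t) (hte : t ≤ ε)
    (w : ℝ → ℝ → ℂ) (A : ℝ → ℂ) (hA : AEMeasurable (fun ξ => ‖A ξ‖ₑ))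
    (ξ : ℝ) (hw : IntegrableOn (w ξ) (Ioi 0)) (hw1 : ContDiffOn ℝ 1 (w ξ) (Ici 0))
    (hw0 : w ξ 0 = 0) :
    ∫⁻ y in Ioi (0:ℝ), ‖Bcal ε t w A ξ y‖ₑ * ‖w ξ y‖ₑ * ENNReal.ofReal (rho ε t y ^ 2) ≤
      216 * (ENNReal.ofReal ε⁻¹ * ‖A ξ‖ₑ * sl ε t (w ξ)
        + ENNReal.ofReal (√(brak ξ)) * ‖A ξ‖ₑ * sl ε t (deriv (w ξ))
        + ENNReal.ofReal |ξ| * sl ε t (w ξ) ^ 2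
        + Qc A ξ * sl ε t (w ξ)) := by
  have hm : AEMeasurable (w ξ) (volume.restrict (Ioi 0)) := hw.aemeasurable
  have hJ := J_le hε ht hte hm
  have hC := conv_le hε ht hte hm
  have hGw := gauss_w_le hε ht hw1 hw0 ξ
  set J := (∫⁻ y in Ioi (0:ℝ), ‖w ξ y‖ₑ) with hJd
  set S := sl ε t (w ξ)
  set V := sl ε t (deriv (w ξ))
  set a := ‖A ξ‖ₑ with ha
  set X := ENNReal.ofReal |ξ|
  set Q := Qc A ξ
  set M := (ENNReal.ofReal (8 * ε⁻¹) * a + X * J + 7 * Q)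
  set B := ENNReal.ofReal (√(brak ξ))
  calc _ ≤ ∫⁻ y in Ioi (0:ℝ), (M * ‖w ξ y‖ₑ
        + (9 * a) * (ENNReal.ofReal ((1 + ξ ^ 2) * Real.exp (-(y ^ 2 * (1 + ξ ^ 2) / 16))) * ‖w ξ y‖ₑ)
        + X * ((∫⁻ z in Ioi y, ‖w ξ z‖ₑ) * (‖w ξ y‖ₑ * ENNReal.ofReal (rho ε t y ^ 2)))) := by
        apply setLIntegral_mono' measurableSet_Ioi
        intro y hy
        calc _ = (‖Bcal ε t w A ξ y‖ₑ * ENNReal.ofReal (rho ε t y ^ 2)) * ‖w ξ y‖ₑ := by ring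
          _ ≤ _ := mul_le_mul_left (B_pt hε hε1 ht hte w A hA ξ hw hy) _
          _ = _ := by ring
    _ = M * J + (9 * a) * (∫⁻ y in Ioi (0:ℝ),
          ENNReal.ofReal ((1 + ξ ^ 2) * Real.exp (-(y ^ 2 * (1 + ξ ^ 2) / 16))) * ‖w ξ y‖ₑ)
        + X * ∫⁻ y in Ioi (0:ℝ), (∫⁻ z in Ioi y, ‖w ξ z‖ₑ) *
            (‖w ξ y‖ₑ * ENNReal.ofReal (rho ε t y ^ 2)) := by
        have hme := hm.enorm
        have hg : AEMeasurable (fun y : ℝ => ENNReal.ofReal ((1 + ξ ^ 2) *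
            Real.exp (-(y ^ 2 * (1 + ξ ^ 2) / 16)))) (volume.restrict (Ioi 0)) :=
          Measurable.aemeasurable (by fun_prop)
        rw [lintegral_add_left' (by fun_prop), lintegral_add_left' (by fun_prop),
          lintegral_const_mul'' _ hme, lintegral_const_mul' X _ ENNReal.ofReal_ne_top,
          lintegral_const_mul'' (9 * a) (show AEMeasurable (fun y => _ * _) _ from hg.mul hme)]
    _ ≤ (ENNReal.ofReal (8 * ε⁻¹) * a + X * (3 * S) + 7 * Q) * (3 * S)
        + (9 * a) * (24 * B * V) + X * (16 * S ^ 2) := by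
        simp only [M]; gcongr
    _ = 24 * (ENNReal.ofReal ε⁻¹ * a * S) + 216 * (B * a * V) + 25 * (X * S ^ 2)
        + 21 * (Q * S) := by
        rw [ENNReal.ofReal_mul (by norm_num), ENNReal.ofReal_ofNat]; ring
    _ ≤ 216 * (ENNReal.ofReal ε⁻¹ * a * S) + 216 * (B * a * V) + 216 * (X * S ^ 2)
        + 216 * (Q * S) := by
        gcongr <;> norm_num
    _ = _ := by ring


def gw (τ r ξ : ℝ) : ℝ := Real.exp (τ * |ξ|) * brak ξ ^ r

lemma gw_pos (τ r ξ : ℝ) : 0 < gw τ r ξ :=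
  mul_pos (Real.exp_pos _) (Real.rpow_pos_of_pos (brak_pos ξ) _)

lemma brak_cont : Continuous brak := by unfold brak; fun_prop

lemma gw_meas (τ r : ℝ) : Measurable (gw τ r) := by
  unfold gw
  have := brak_cont.measurable
  fun_prop

lemma aWgt_eq (τ r ξ : ℝ) : aWgt τ r ξ = gw τ r ξ ^ 2 := by
  unfold aWgt gw
  rw [mul_pow, ← Real.exp_nat_mul, ← Real.rpow_natCast, ← Real.rpow_mul (brak_pos ξ).le]
  push_cast
  rw [mul_comm r 2, mul_assoc]

lemma wgt_eq (ε t τ r ξ y : ℝ) : wgt ε t τ r ξ y = rho ε t y ^ 2 * gw τ r ξ ^ 2 := by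
  rw [← aWgt_eq, wgt, aWgt, mul_assoc]

lemma ofReal_sqrt_eq {x : ℝ} : ENNReal.ofReal (√x) = ENNReal.ofReal x ^ (1 / 2 : ℝ) := by
  rcases le_total 0 x with h | h
  · rw [ENNReal.ofReal_rpow_of_nonneg h (by norm_num), Real.sqrt_eq_rpow]
  · rw [Real.sqrt_eq_zero_of_nonpos h, ENNReal.ofReal_of_nonpos h]; simp

lemma aNorm_eq {τ r : ℝ} {m : ℝ → ℝ} {A : ℝ → ℂ} (hm : ∀ ξ, 0 ≤ m ξ) (h : aFinite τ r m A) :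
    ENNReal.ofReal (aNorm τ r m A) =
      (∫⁻ ξ, ENNReal.ofReal (m ξ) * (ENNReal.ofReal (gw τ r ξ) * ‖A ξ‖ₑ) ^ 2) ^ (1 / 2 : ℝ) := by
  unfold aNorm
  rw [ofReal_sqrt_eq, ofReal_integral_eq_lintegral_ofReal h]
  · congr 1
    apply lintegral_congr
    intro ξ
    rw [aWgt_eq, mul_assoc, ENNReal.ofReal_mul (hm ξ), ← mul_pow,
      ENNReal.ofReal_pow (mul_nonneg (norm_nonneg _) (gw_pos _ _ _).le),
      ENNReal.ofReal_mul (norm_nonneg _), ofReal_norm, mul_comm (‖A ξ‖ₑ)]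
  · refine Eventually.of_forall fun ξ => ?_
    simp only [Pi.zero_apply]
    rw [aWgt_eq]
    have := hm ξ
    positivity

lemma wNorm_int {ε t τ r : ℝ} {m : ℝ → ℝ} {w : ℝ → ℝ → ℂ} (hm : ∀ ξ, 0 ≤ m ξ) (ξ : ℝ) :
    ∫⁻ y in Ioi (0:ℝ), ENNReal.ofReal (m ξ * ‖w ξ y‖ ^ 2 * wgt ε t τ r ξ y) =
      ENNReal.ofReal (m ξ) * (ENNReal.ofReal (gw τ r ξ) * sl ε t (w ξ)) ^ 2 := by
  rw [mul_pow, sl, sqrt_sq_enn, ← mul_assoc, ← lintegral_const_mul' _ _ (by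
    exact ENNReal.mul_ne_top ENNReal.ofReal_ne_top (ENNReal.pow_ne_top ENNReal.ofReal_ne_top))]
  apply lintegral_congr
  intro y
  have h1 := (rho_pos ε t y).le
  have h2 := (gw_pos τ r ξ).le
  rw [wgt_eq, mul_assoc, ENNReal.ofReal_mul (hm ξ), ENNReal.ofReal_mul (by positivity),
    ENNReal.ofReal_mul (by positivity), ENNReal.ofReal_pow (norm_nonneg _),
    ENNReal.ofReal_pow h1, ENNReal.ofReal_pow h2, ofReal_norm]
  ring

lemma wNorm_eq {ε t τ r : ℝ} {m : ℝ → ℝ} {w : ℝ → ℝ → ℂ} (hm : ∀ ξ, 0 ≤ m ξ)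
    (h : wFinite ε t τ r m w) :
    ENNReal.ofReal (wNorm ε t τ r m w) =
      (∫⁻ ξ, ENNReal.ofReal (m ξ) * (ENNReal.ofReal (gw τ r ξ) * sl ε t (w ξ)) ^ 2) ^ (1 / 2 : ℝ) := by
  unfold wNorm
  have hp := integral_prod _ h
  simp only at hp
  rw [ofReal_sqrt_eq, ← hp, ofReal_integral_eq_lintegral_ofReal h]
  · rw [lintegral_prod _ (by exact h.aemeasurable.ennreal_ofReal)]
    congr 1
    apply lintegral_congr
    intro ξ
    exact wNorm_int hm ξ
  · refine Eventually.of_forall fun p => ?_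
    simp only [Pi.zero_apply]
    rw [wgt_eq]
    have := hm p.1
    positivity

lemma A_meas {τ r : ℝ} {A : ℝ → ℂ} (h : aFinite τ r (fun _ => 1) A) :
    AEMeasurable (fun ξ => ‖A ξ‖ₑ) := by
  have h1 := h.aemeasurable
  have h2 : AEMeasurable (fun ξ => ENNReal.ofReal (√(1 * ‖A ξ‖ ^ 2 * aWgt τ r ξ) * (gw τ r ξ)⁻¹)) :=
    ((h1.sqrt).mul (gw_meas τ r).inv.aemeasurable).ennreal_ofReal
  refine h2.congr (Eventually.of_forall fun ξ => ?_)
  simp only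
  have := gw_pos τ r ξ
  rw [one_mul, aWgt_eq, ← mul_pow, Real.sqrt_sq (by positivity), mul_assoc,
    mul_inv_cancel₀ this.ne', mul_one, ofReal_norm]

lemma sl_meas {ε t τ r : ℝ} {w : ℝ → ℝ → ℂ} (h : wFinite ε t τ r (fun _ => 1) w) :
    AEMeasurable (fun ξ => sl ε t (w ξ)) := by
  have h1 := (AEMeasurable.lintegral_prod_right' h.aemeasurable.ennreal_ofReal)
  simp only at h1
  have h2 : AEMeasurable (fun ξ => (∫⁻ y in Ioi (0:ℝ),
      ENNReal.ofReal (1 * ‖w ξ y‖ ^ 2 * wgt ε t τ r ξ y)) ^ (1 / 2 : ℝ) *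
        ENNReal.ofReal (gw τ r ξ)⁻¹) :=
    (h1.pow_const _).mul (gw_meas τ r).inv.ennreal_ofReal.aemeasurable
  refine h2.congr (Eventually.of_forall fun ξ => ?_)
  simp only
  have := wNorm_int (ε := ε) (t := t) (τ := τ) (r := r) (m := fun _ => 1) (w := w)
    (fun _ => zero_le_one) ξ
  have hg := gw_pos τ r ξ
  rw [this, ENNReal.ofReal_one, one_mul, sq_sqrt_enn, mul_comm, ← mul_assoc,
    ← ENNReal.ofReal_mul (by positivity), inv_mul_cancel₀ hg.ne', ENNReal.ofReal_one, one_mul]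

lemma brak_add (η ζ : ℝ) : brak (η + ζ) ≤ brak η + brak ζ := by
  have h1 := brak_pos η
  have h2 := brak_pos ζ
  have a := brak_sq η
  have b := brak_sq ζ
  have c : η * ζ ≤ brak η * brak ζ :=
    (le_abs_self _).trans (by
      rw [abs_mul]; exact mul_le_mul (abs_le_brak _) (abs_le_brak _) (abs_nonneg _) h1.le)
  rw [brak, Real.sqrt_le_left (by positivity)]
  nlinarith

lemma add_rpow_le {x y r : ℝ} (hx : 0 ≤ x) (hy : 0 ≤ y) (hr : 0 ≤ r) :
    (x + y) ^ r ≤ 2 ^ r * (x ^ r + y ^ r) := by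
  wlog h : x ≤ y generalizing x y
  · rw [add_comm x, add_comm (x ^ r)]; exact this hy hx (le_of_not_ge h)
  calc (x + y) ^ r ≤ (2 * y) ^ r := Real.rpow_le_rpow (by positivity) (by linarith) hr
    _ = 2 ^ r * y ^ r := Real.mul_rpow (by norm_num) hy
    _ ≤ _ := by
      have := Real.rpow_nonneg hx r
      gcongr; linarith

lemma gw_ineq {τ r : ℝ} (hτ : 0 < τ) (hr : 2 < r) (η ζ : ℝ) :
    gw τ r (η + ζ) * |ζ| ≤ 2 ^ (r + 1) * √(brak (η + ζ)) * (gw τ r η * (√|ζ| * gw τ r ζ) *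
      (brak ζ ^ (1 / 2 - r) + brak η ^ (1 / 2 - r))) := by
  have hx := one_le_brak (η + ζ)
  have he := one_le_brak η
  have hz := one_le_brak ζ
  have hadd := brak_add η ζ
  have hzz : √|ζ| ≤ √(brak ζ) := Real.sqrt_le_sqrt (abs_le_brak ζ)
  have hxi : √|ζ| ≤ 2 * √(brak (η + ζ)) * √(brak η) := by
    have h1 : |ζ| ≤ 4 * (brak (η + ζ) * brak η) := by
      have : |ζ| ≤ |η + ζ| + |η| := by
        calc |ζ| = |(η + ζ) - η| := by ring_nf
          _ ≤ _ := abs_sub _ _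
      have := abs_le_brak (η + ζ)
      have := abs_le_brak η
      nlinarith
    rw [Real.sqrt_le_left (by positivity), mul_pow, mul_pow, Real.sq_sqrt (by positivity),
      Real.sq_sqrt (by positivity)]
    linarith
  have hsx : 1 ≤ √(brak (η + ζ)) := by rw [Real.one_le_sqrt]; exact hx
  set bx := brak (η + ζ)
  set be := brak η
  set bz := brak ζ
  have hbe : 0 < be := by linarith
  have hbz : 0 < bz := by linarith
  have hbx : 0 < bx := by linarith
  have hpow : bx ^ r ≤ 2 ^ r * (be ^ r + bz ^ r) :=
    (Real.rpow_le_rpow (by positivity) hadd (by linarith)).trans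
      (add_rpow_le hbe.le hbz.le (by linarith))
  have hE : Real.exp (τ * |η + ζ|) ≤ Real.exp (τ * |η|) * Real.exp (τ * |ζ|) := by
    rw [← Real.exp_add]
    apply Real.exp_le_exp.mpr
    rw [← mul_add]
    gcongr
    exact abs_add_le _ _
  have e1 : bz ^ r * bz ^ (1 / 2 - r) = √bz := by
    rw [← Real.rpow_add hbz, Real.sqrt_eq_rpow]; congr 1; ring
  have e2 : be ^ r * be ^ (1 / 2 - r) = √be := by
    rw [← Real.rpow_add hbe, Real.sqrt_eq_rpow]; congr 1; ring
  have e3 : |ζ| = √|ζ| * √|ζ| := (Real.mul_self_sqrt (abs_nonneg _)).symm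
  have e4 : (2:ℝ) ^ (r + 1) = 2 ^ r * 2 := Real.rpow_add_one (by norm_num) r
  have hP : 0 < be ^ r := Real.rpow_pos_of_pos hbe _
  have hQ : 0 < bz ^ r := Real.rpow_pos_of_pos hbz _
  have h2 : (0:ℝ) < 2 ^ r := Real.rpow_pos_of_pos (by norm_num) _
  have key : (be ^ r + bz ^ r) * √|ζ| ≤ 2 * √bx * (be ^ r * √bz + bz ^ r * √be) := by
    rw [add_mul, mul_add]
    apply add_le_add
    · calc be ^ r * √|ζ| ≤ be ^ r * √bz := by gcongr
        _ = 1 * (be ^ r * √bz) := (one_mul _).symm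
        _ ≤ 2 * √bx * (be ^ r * √bz) := by gcongr; linarith
    · calc bz ^ r * √|ζ| ≤ bz ^ r * (2 * √bx * √be) := by gcongr
        _ = _ := by ring
  unfold gw
  calc Real.exp (τ * |η + ζ|) * bx ^ r * |ζ|
      ≤ (Real.exp (τ * |η|) * Real.exp (τ * |ζ|)) * (2 ^ r * (be ^ r + bz ^ r)) * (√|ζ| * √|ζ|) := by
        rw [← e3]; gcongr
    _ = (Real.exp (τ * |η|) * Real.exp (τ * |ζ|) * 2 ^ r * √|ζ|) * ((be ^ r + bz ^ r) * √|ζ|) := by ring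
    _ ≤ (Real.exp (τ * |η|) * Real.exp (τ * |ζ|) * 2 ^ r * √|ζ|) *
        (2 * √bx * (be ^ r * √bz + bz ^ r * √be)) := by gcongr
    _ = _ := by
        rw [e4, ← e1, ← e2]; ring

lemma tri_meas {F β h : ℝ → ENNReal} (hF : Measurable F) (hβ : Measurable β) (hh : Measurable h) :
    ∫⁻ ξ, ∫⁻ η, F ξ * (β η * h (ξ - η)) ≤
      (∫⁻ ξ, F ξ ^ 2) ^ (1 / 2 : ℝ) * (∫⁻ ξ, β ξ ^ 2) ^ (1 / 2 : ℝ) * ∫⁻ ξ, h ξ := by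
  calc _ = ∫⁻ ξ, ∫⁻ η, F ξ * (β (ξ - η) * h η) := by
        apply lintegral_congr
        intro ξ
        rw [← lintegral_sub_left_eq_self _ ξ]
        simp only [sub_sub_cancel]
    _ = ∫⁻ η, ∫⁻ ξ, F ξ * (β (ξ - η) * h η) :=
        lintegral_lintegral_swap (Measurable.aemeasurable (by
          unfold Function.uncurry; fun_prop))
    _ ≤ ∫⁻ η, ((∫⁻ ξ, F ξ ^ 2) ^ (1 / 2 : ℝ) * (∫⁻ ξ, β ξ ^ 2) ^ (1 / 2 : ℝ)) * h η := by
        apply lintegral_mono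
        intro η
        simp only
        simp_rw [← mul_assoc]
        rw [lintegral_mul_const _ (by fun_prop)]
        gcongr
        refine (cs_lint volume hF.aemeasurable (by fun_prop)).trans ?_
        rw [lintegral_sub_right_eq_self (fun x => β x ^ 2)]
    _ = _ := lintegral_const_mul _ hh

lemma tri {F β h : ℝ → ENNReal} (hF : AEMeasurable F) (hβ : AEMeasurable β) (hh : AEMeasurable h) :
    ∫⁻ ξ, ∫⁻ η, F ξ * (β η * h (ξ - η)) ≤
      (∫⁻ ξ, F ξ ^ 2) ^ (1 / 2 : ℝ) * (∫⁻ ξ, β ξ ^ 2) ^ (1 / 2 : ℝ) * ∫⁻ ξ, h ξ := by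
  have := tri_meas hF.measurable_mk hβ.measurable_mk hh.measurable_mk
  have e1 : ∫⁻ ξ, F ξ ^ 2 = ∫⁻ ξ, hF.mk F ξ ^ 2 :=
    lintegral_congr_ae (hF.ae_eq_mk.mono fun x hx => by simp only [hx])
  have e2 : ∫⁻ ξ, β ξ ^ 2 = ∫⁻ ξ, hβ.mk β ξ ^ 2 :=
    lintegral_congr_ae (hβ.ae_eq_mk.mono fun x hx => by simp only [hx])
  have e3 : ∫⁻ ξ, h ξ = ∫⁻ ξ, hh.mk h ξ := lintegral_congr_ae hh.ae_eq_mk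
  rw [e1, e2, e3]
  refine le_trans (le_of_eq ?_) this
  apply lintegral_congr_ae
  filter_upwards [hF.ae_eq_mk] with ξ hξ
  apply lintegral_congr_ae
  have := (quasiMeasurePreserving_sub_left volume ξ).ae_eq_comp hh.ae_eq_mk
  filter_upwards [hβ.ae_eq_mk, this] with η h1 h2
  simp only [Function.comp] at h2
  rw [hξ, h1, h2]

def kw (r ξ : ℝ) : ENNReal := ENNReal.ofReal (brak ξ ^ (1 / 2 - r))

def Kn (r : ℝ) : ENNReal := (∫⁻ ξ, kw r ξ ^ 2) ^ (1 / 2 : ℝ)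

lemma kw_meas (r : ℝ) : Measurable (kw r) := by
  unfold kw
  have := brak_cont.measurable
  fun_prop

lemma Kn_ne_top {r : ℝ} (hr : 2 < r) : Kn r ≠ ⊤ := by
  unfold Kn
  apply ENNReal.rpow_ne_top_of_nonneg (by norm_num)
  have h := integrable_rpow_neg_one_add_norm_sq (E := ℝ) (μ := volume) (r := 2 * r - 1)
    (by simp; linarith)
  have e : ∀ ξ, kw r ξ ^ 2 = ENNReal.ofReal ((1 + ‖ξ‖ ^ 2) ^ (-(2 * r - 1) / 2)) := by
    intro ξ
    unfold kw
    have hb := brak_pos ξ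
    rw [← ENNReal.ofReal_pow (by positivity), ← Real.rpow_natCast, ← Real.rpow_mul hb.le, brak,
      Real.sqrt_eq_rpow, ← Real.rpow_mul (by positivity), Real.norm_eq_abs, sq_abs]
    congr 2
    push_cast
    ring
  simp_rw [e]
  exact (Integrable.lintegral_lt_top h).ne

set_option maxHeartbeats 1600000 in
lemma QS_le {τ r : ℝ} (hτ : 0 < τ) (hr : 2 < r) {A : ℝ → ℂ} (hA : AEMeasurable (fun ξ => ‖A ξ‖ₑ))
    {S : ℝ → ENNReal} (hS : AEMeasurable S) :
    ∫⁻ ξ, ENNReal.ofReal (gw τ r ξ) ^ 2 * (Qc A ξ * S ξ) ≤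
      (ENNReal.ofReal (2 ^ (r + 1)) * (2 * Kn r)) *
      ((∫⁻ ξ, ENNReal.ofReal (brak ξ) * (ENNReal.ofReal (gw τ r ξ) * S ξ) ^ 2) ^ (1 / 2 : ℝ) *
      (∫⁻ ξ, ENNReal.ofReal |ξ| * (ENNReal.ofReal (gw τ r ξ) * ‖A ξ‖ₑ) ^ 2) ^ (1 / 2 : ℝ) *
      (∫⁻ ξ, (ENNReal.ofReal (gw τ r ξ) * ‖A ξ‖ₑ) ^ 2) ^ (1 / 2 : ℝ)) := by
  have hg := gw_meas τ r
  have hbm := brak_cont.measurable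
  have hk := kw_meas r
  set β : ℝ → ENNReal := fun ξ => ENNReal.ofReal (gw τ r ξ) * ‖A ξ‖ₑ with hβ
  set γ : ℝ → ENNReal := fun ξ => ENNReal.ofReal (√|ξ|) * β ξ with hγ
  set F : ℝ → ENNReal := fun ξ => ENNReal.ofReal (√(brak ξ)) * (ENNReal.ofReal (gw τ r ξ) * S ξ) with hF
  have hβm : AEMeasurable β := AEMeasurable.mul (by fun_prop) hA
  have hγm : AEMeasurable γ := AEMeasurable.mul (by fun_prop) hβm
  have hFm : AEMeasurable F := AEMeasurable.mul (by fun_prop) (AEMeasurable.mul (by fun_prop) hS)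
  have hF2 : ∫⁻ ξ, F ξ ^ 2 = ∫⁻ ξ, ENNReal.ofReal (brak ξ) * (ENNReal.ofReal (gw τ r ξ) * S ξ) ^ 2 := by
    apply lintegral_congr; intro ξ
    simp only [hF]
    rw [mul_pow, ← ENNReal.ofReal_pow (by positivity), Real.sq_sqrt (brak_pos ξ).le]
  have hγ2 : ∫⁻ ξ, γ ξ ^ 2 = ∫⁻ ξ, ENNReal.ofReal |ξ| * β ξ ^ 2 := by
    apply lintegral_congr; intro ξ
    simp only [hγ]
    rw [mul_pow, ← ENNReal.ofReal_pow (by positivity), Real.sq_sqrt (abs_nonneg ξ)]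
  rw [← hF2, ← hγ2]
  set C := ENNReal.ofReal (2 ^ (r + 1)) with hC
  have hgk : AEMeasurable (fun ξ => γ ξ * kw r ξ) := hγm.mul hk.aemeasurable
  have hbk : AEMeasurable (fun ξ => β ξ * kw r ξ) := hβm.mul hk.aemeasurable
  have t1 := tri hFm hβm hgk
  have t2 := tri hFm hγm hbk
  have c1 := cs_lint volume hγm hk.aemeasurable
  have c2 := cs_lint volume hβm hk.aemeasurable
  calc _ ≤ ∫⁻ ξ, ∫⁻ η, C * (F ξ * (β η * (γ (ξ - η) * kw r (ξ - η)))
        + F ξ * ((β η * kw r η) * γ (ξ - η))) := by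
        apply lintegral_mono
        intro ξ
        simp only
        have : ENNReal.ofReal (gw τ r ξ) ^ 2 * (Qc A ξ * S ξ) =
          (ENNReal.ofReal (gw τ r ξ) * S ξ) * (ENNReal.ofReal (gw τ r ξ) * Qc A ξ) := by ring
        rw [this, Qc, ← lintegral_const_mul' _ _ ENNReal.ofReal_ne_top]
        have hAm2 : AEMeasurable (fun η => ‖A (ξ - η)‖ₑ) :=
          hA.comp_quasiMeasurePreserving (quasiMeasurePreserving_sub_left volume ξ)
        rw [← lintegral_const_mul'' _ (by fun_prop)]
        apply lintegral_mono
        intro η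
        simp only
        have key := gw_ineq hτ hr η (ξ - η)
        rw [add_sub_cancel] at key
        have key2 : ENNReal.ofReal (gw τ r ξ) * ENNReal.ofReal |ξ - η| ≤
            C * ENNReal.ofReal (√(brak ξ)) * (ENNReal.ofReal (gw τ r η) *
              (ENNReal.ofReal (√|ξ - η|) * ENNReal.ofReal (gw τ r (ξ - η))) *
              (kw r (ξ - η) + kw r η)) := by
          have p1 := (gw_pos τ r ξ).le
          have p2 := (gw_pos τ r η).le
          have p3 := (gw_pos τ r (ξ - η)).le
          have q1 := (brak_pos η).le
          have q2 := (brak_pos (ξ - η)).le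
          unfold kw
          rw [hC, ← ENNReal.ofReal_add (by positivity) (by positivity),
            ← ENNReal.ofReal_mul (by positivity), ← ENNReal.ofReal_mul (by positivity),
            ← ENNReal.ofReal_mul (by positivity), ← ENNReal.ofReal_mul (by positivity),
            ← ENNReal.ofReal_mul (by positivity), ← ENNReal.ofReal_mul (by positivity)]
          exact ENNReal.ofReal_le_ofReal key
        calc _ = (ENNReal.ofReal (gw τ r ξ) * ENNReal.ofReal |ξ - η|) *
              ((ENNReal.ofReal (gw τ r ξ) * S ξ) * ‖A η‖ₑ * ‖A (ξ - η)‖ₑ) := by ring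
          _ ≤ _ := mul_le_mul_left key2 _
          _ = _ := by simp only [hF, hγ, hβ]; ring
    _ = C * ((∫⁻ ξ, ∫⁻ η, F ξ * (β η * (γ (ξ - η) * kw r (ξ - η))))
        + ∫⁻ ξ, ∫⁻ η, F ξ * (γ η * (β (ξ - η) * kw r (ξ - η)))) := by
        rw [← lintegral_add_left', ← lintegral_const_mul' _ _ ENNReal.ofReal_ne_top]
        · apply lintegral_congr
          intro ξ
          rw [lintegral_const_mul' _ _ ENNReal.ofReal_ne_top]
          congr 1
          rw [lintegral_add_left']
          · congr 1
            rw [← lintegral_sub_left_eq_self _ ξ]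
            apply lintegral_congr
            intro η
            rw [sub_sub_cancel]
            ring
          · have : AEMeasurable (fun η => γ (ξ - η) * kw r (ξ - η)) :=
              hgk.comp_quasiMeasurePreserving (quasiMeasurePreserving_sub_left volume ξ)
            exact AEMeasurable.const_mul (hβm.mul this) _
        · refine AEMeasurable.lintegral_prod_right' (f := fun p : ℝ × ℝ =>
            F p.1 * (β p.2 * (γ (p.1 - p.2) * kw r (p.1 - p.2)))) ?_
          have h3 : AEMeasurable (fun p : ℝ × ℝ => γ (p.1 - p.2) * kw r (p.1 - p.2))
              (volume.prod volume) :=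
            hgk.comp_quasiMeasurePreserving (quasiMeasurePreserving_sub_of_right_invariant volume volume)
          exact hFm.comp_fst.mul (hβm.comp_snd.mul h3)
    _ ≤ C * ((∫⁻ ξ, F ξ ^ 2) ^ (1 / 2 : ℝ) * (∫⁻ ξ, β ξ ^ 2) ^ (1 / 2 : ℝ) *
          ((∫⁻ ξ, γ ξ ^ 2) ^ (1 / 2 : ℝ) * Kn r)
        + (∫⁻ ξ, F ξ ^ 2) ^ (1 / 2 : ℝ) * (∫⁻ ξ, γ ξ ^ 2) ^ (1 / 2 : ℝ) *
          ((∫⁻ ξ, β ξ ^ 2) ^ (1 / 2 : ℝ) * Kn r)) := by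
        refine mul_le_mul_right (add_le_add (t1.trans ?_) (t2.trans ?_)) _
        · exact mul_le_mul_right c1 _
        · exact mul_le_mul_right c2 _
    _ = _ := by ring


lemma F_slice {ε t τ r : ℝ} {w : ℝ → ℝ → ℂ} {A : ℝ → ℂ} (ξ : ℝ) :
    ∫⁻ y in Ioi (0:ℝ), ‖Bcal ε t w A ξ y * (starRingEnd ℂ) (w ξ y) * ((wgt ε t τ r ξ y : ℝ) : ℂ)‖ₑ
      = ENNReal.ofReal (gw τ r ξ) ^ 2 *
        ∫⁻ y in Ioi (0:ℝ), ‖Bcal ε t w A ξ y‖ₑ * ‖w ξ y‖ₑ * ENNReal.ofReal (rho ε t y ^ 2) := by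
  rw [← lintegral_const_mul' _ _ (ENNReal.pow_ne_top ENNReal.ofReal_ne_top)]
  apply lintegral_congr
  intro y
  have h1 : ‖(starRingEnd ℂ) (w ξ y)‖ₑ = ‖w ξ y‖ₑ := by
    rw [← ofReal_norm, ← ofReal_norm, RCLike.norm_conj]
  have hg := (gw_pos τ r ξ).le
  have h2 : ‖((wgt ε t τ r ξ y : ℝ) : ℂ)‖ₑ =
      ENNReal.ofReal (rho ε t y ^ 2) * ENNReal.ofReal (gw τ r ξ) ^ 2 := by
    rw [← ofReal_norm, Complex.norm_real, Real.norm_eq_abs, wgt_eq, abs_of_nonneg (by positivity),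
      ENNReal.ofReal_mul (by positivity), ENNReal.ofReal_pow hg]
  rw [enorm_mul, enorm_mul, h1, h2]
  ring

lemma main_enn {r ε t τ : ℝ} (hr : 2 < r) (hε : 0 < ε) (hε1 : ε ≤ 1) (ht : 0 ≤ t) (hte : t ≤ ε)
    (hτ : 0 < τ) {w : ℝ → ℝ → ℂ} {A : ℝ → ℂ}
    (hw1 : ∀ ξ : ℝ, ContDiffOn ℝ 1 (w ξ) (Ici 0)) (hw0 : ∀ ξ : ℝ, w ξ 0 = 0)
    (f1 : wFinite ε t τ r (fun _ => 1) w) (f2 : wFinite ε t τ r (fun ξ => |ξ|) w)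
    (f3 : wFinite ε t τ r brak w)
    (f4 : wFinite ε t τ r (fun _ => 1) (fun ξ y => deriv (w ξ) y))
    (a1 : aFinite τ r (fun _ => 1) A) (a2 : aFinite τ r (fun ξ => |ξ|) A)
    (a3 : aFinite τ r brak A) (hi : ∀ ξ : ℝ, IntegrableOn (w ξ) (Ioi 0)) :
    ‖∫ ξ : ℝ, ∫ y in Ioi (0 : ℝ),
          Bcal ε t w A ξ y * (starRingEnd ℂ) (w ξ y) * ((wgt ε t τ r ξ y : ℝ) : ℂ)‖ₑ ≤
    216 * (ENNReal.ofReal ε⁻¹ * (ENNReal.ofReal (aNorm τ r (fun _ => 1) A) *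
        ENNReal.ofReal (wNorm ε t τ r (fun _ => 1) w))
      + ENNReal.ofReal (aNorm τ r brak A) *
        ENNReal.ofReal (wNorm ε t τ r (fun _ => 1) (fun ξ y => deriv (w ξ) y))
      + ENNReal.ofReal (wNorm ε t τ r (fun ξ => |ξ|) w) ^ 2
      + (ENNReal.ofReal (2 ^ (r + 1)) * (2 * Kn r)) * (ENNReal.ofReal (wNorm ε t τ r brak w) *
        ENNReal.ofReal (aNorm τ r (fun ξ => |ξ|) A) *
        ENNReal.ofReal (aNorm τ r (fun _ => 1) A))) := by
  have hA := A_meas a1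
  have hS := sl_meas f1
  have hV := sl_meas f4
  have hg := gw_meas τ r
  have hbm := brak_cont.measurable
  have hq := QS_le hτ hr hA hS
  have z1 : ∀ ξ : ℝ, (0:ℝ) ≤ (fun _ => (1:ℝ)) ξ := fun _ => zero_le_one
  rw [aNorm_eq z1 a1, aNorm_eq (fun ξ => (brak_pos ξ).le) a3, aNorm_eq (fun ξ => abs_nonneg ξ) a2,
    wNorm_eq z1 f1, wNorm_eq z1 f4, wNorm_eq (fun ξ => abs_nonneg ξ) f2,
    wNorm_eq (fun ξ => (brak_pos ξ).le) f3]
  simp only [ENNReal.ofReal_one, one_mul]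
  set S : ℝ → ENNReal := fun ξ => sl ε t (w ξ) with hSd
  set V : ℝ → ENNReal := fun ξ => sl ε t (deriv (w ξ)) with hVd
  set a : ℝ → ENNReal := fun ξ => ‖A ξ‖ₑ with had
  set g : ℝ → ENNReal := fun ξ => ENNReal.ofReal (gw τ r ξ) with hgd
  have hgm : Measurable g := hg.ennreal_ofReal
  have hga : AEMeasurable (fun ξ => g ξ * a ξ) := hgm.aemeasurable.mul hA
  have hgS : AEMeasurable (fun ξ => g ξ * S ξ) := hgm.aemeasurable.mul hS
  have hgV : AEMeasurable (fun ξ => g ξ * V ξ) := hgm.aemeasurable.mul hV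
  have hsb : Measurable (fun ξ => ENNReal.ofReal (√(brak ξ))) := by fun_prop
  have hbga : AEMeasurable (fun ξ => ENNReal.ofReal (√(brak ξ)) * (g ξ * a ξ)) :=
    hsb.aemeasurable.mul hga
  have hab : Measurable (fun ξ : ℝ => ENNReal.ofReal |ξ|) := by fun_prop
  have c1 := cs_lint volume hga hgS
  have c2 := cs_lint volume hbga hgV
  have e2 : ∫⁻ ξ, (ENNReal.ofReal (√(brak ξ)) * (g ξ * a ξ)) ^ 2 =
      ∫⁻ ξ, ENNReal.ofReal (brak ξ) * (g ξ * a ξ) ^ 2 := by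
    apply lintegral_congr; intro ξ
    rw [mul_pow, ← ENNReal.ofReal_pow (by positivity), Real.sq_sqrt (brak_pos ξ).le]
  rw [e2] at c2
  rw [sqrt_sq_enn]
  have step1 : ‖∫ ξ : ℝ, ∫ y in Ioi (0 : ℝ),
          Bcal ε t w A ξ y * (starRingEnd ℂ) (w ξ y) * ((wgt ε t τ r ξ y : ℝ) : ℂ)‖ₑ ≤
      ∫⁻ ξ, 216 * (ENNReal.ofReal ε⁻¹ * ((g ξ * a ξ) * (g ξ * S ξ))
        + (ENNReal.ofReal (√(brak ξ)) * (g ξ * a ξ)) * (g ξ * V ξ)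
        + ENNReal.ofReal |ξ| * (g ξ * S ξ) ^ 2
        + g ξ ^ 2 * (Qc A ξ * S ξ)) := by
    refine (enorm_integral_le_lintegral_enorm _).trans (lintegral_mono fun ξ => ?_)
    refine (enorm_integral_le_lintegral_enorm _).trans ?_
    rw [F_slice]
    refine (mul_le_mul_right (slice_le hε hε1 ht hte w A hA ξ (hi ξ) (hw1 ξ) (hw0 ξ)) _).trans
      (le_of_eq ?_)
    simp only [hSd, hVd, had, hgd]
    ring
  refine step1.trans ?_
  have m1 : AEMeasurable (fun ξ => ENNReal.ofReal ε⁻¹ * ((g ξ * a ξ) * (g ξ * S ξ))) :=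
    (hga.mul hgS).const_mul _
  have m2 : AEMeasurable (fun ξ => (ENNReal.ofReal (√(brak ξ)) * (g ξ * a ξ)) * (g ξ * V ξ)) :=
    hbga.mul hgV
  have m3 : AEMeasurable (fun ξ => ENNReal.ofReal |ξ| * (g ξ * S ξ) ^ 2) :=
    hab.aemeasurable.mul (hgS.pow_const 2)
  have m12 : AEMeasurable (fun ξ => ENNReal.ofReal ε⁻¹ * ((g ξ * a ξ) * (g ξ * S ξ))
      + (ENNReal.ofReal (√(brak ξ)) * (g ξ * a ξ)) * (g ξ * V ξ)) := m1.add m2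
  have m123 : AEMeasurable (fun ξ => ENNReal.ofReal ε⁻¹ * ((g ξ * a ξ) * (g ξ * S ξ))
      + (ENNReal.ofReal (√(brak ξ)) * (g ξ * a ξ)) * (g ξ * V ξ)
      + ENNReal.ofReal |ξ| * (g ξ * S ξ) ^ 2) := m12.add m3
  rw [lintegral_const_mul' _ _ (by norm_num), lintegral_add_left' m123,
    lintegral_add_left' m12, lintegral_add_left' m1,
    lintegral_const_mul' _ _ ENNReal.ofReal_ne_top]
  exact mul_le_mul_right (add_le_add (add_le_add (add_le_add (mul_le_mul_right c1 _) c2) le_rfl) hq) _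


/-- **Bound (3.17d) of the paper** on `T_ℬ = ∫∫ ℬ_ξ conj(w̄_ξ) ρ² e^{2τ|ξ|}⟨ξ⟩^{2r} dy dξ`. -/
theorem TB_bound :
    ∀ r : ℝ, 2 < r →
    ∃ C : ℝ, 0 < C ∧
    ∀ (ε t τ : ℝ), 0 < ε → ε ≤ 1 → 0 ≤ t → t ≤ ε → 0 < τ →
    ∀ (w : ℝ → ℝ → ℂ) (A : ℝ → ℂ),
      (∀ ξ : ℝ, ContDiffOn ℝ 1 (w ξ) (Ici 0)) →
      (∀ ξ : ℝ, w ξ 0 = 0) →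
      wFinite ε t τ r (fun _ => 1) w →
      wFinite ε t τ r (fun ξ => |ξ|) w →
      wFinite ε t τ r brak w →
      wFinite ε t τ r (fun _ => 1) (fun ξ y => deriv (w ξ) y) →
      aFinite τ r (fun _ => 1) A →
      aFinite τ r (fun ξ => |ξ|) A →
      aFinite τ r brak A →
      (∀ ξ : ℝ, IntegrableOn (w ξ) (Ioi 0)) →
      (∀ ξ : ℝ, Integrable (fun η : ℝ => A η * ((ξ - η : ℝ) : ℂ) * A (ξ - η))) →
      Integrable (fun p : ℝ × ℝ =>
        Bcal ε t w A p.1 p.2 * (starRingEnd ℂ) (w p.1 p.2) *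
          ((wgt ε t τ r p.1 p.2 : ℝ) : ℂ))
        ((volume : Measure ℝ).prod ((volume : Measure ℝ).restrict (Ioi 0))) →
      ‖∫ ξ : ℝ, ∫ y in Ioi (0 : ℝ),
          Bcal ε t w A ξ y * (starRingEnd ℂ) (w ξ y) * ((wgt ε t τ r ξ y : ℝ) : ℂ)‖
        ≤ C * (ε⁻¹ * wNorm ε t τ r (fun _ => 1) w * aNorm τ r (fun _ => 1) A
            + aNorm τ r brak A * wNorm ε t τ r (fun _ => 1) (fun ξ y => deriv (w ξ) y)
            + (wNorm ε t τ r (fun ξ => |ξ|) w) ^ 2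
            + wNorm ε t τ r (fun ξ => |ξ|) w * wNorm ε t τ r (fun _ => 1) w
            + wNorm ε t τ r brak w * aNorm τ r (fun ξ => |ξ|) A *
                aNorm τ r (fun _ => 1) A) := by
  intro r hr
  have hK : 0 ≤ (Kn r).toReal := ENNReal.toReal_nonneg
  have h2 : (0:ℝ) < 2 ^ (r + 1) := by positivity
  refine ⟨216 * (1 + 2 ^ (r + 1) * (2 * (Kn r).toReal)), by positivity, ?_⟩
  intro ε t τ hε hε1 ht hte hτ w A hw1 hw0 f1 f2 f3 f4 a1 a2 a3 hi _ _
  have h := main_enn hr hε hε1 ht hte hτ hw1 hw0 f1 f2 f3 f4 a1 a2 a3 hi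
  have wn : ∀ (m : ℝ → ℝ) (v : ℝ → ℝ → ℂ), 0 ≤ wNorm ε t τ r m v := fun _ _ => Real.sqrt_nonneg _
  have an : ∀ (m : ℝ → ℝ), 0 ≤ aNorm τ r m A := fun _ => Real.sqrt_nonneg _
  have n1 := wn (fun _ => 1) w
  have n2 := wn (fun ξ => |ξ|) w
  have n3 := wn brak w
  have n4 := wn (fun _ => 1) (fun ξ y => deriv (w ξ) y)
  have b1 := an (fun _ => 1)
  have b2 := an (fun ξ => |ξ|)
  have b3 := an brak
  generalize wNorm ε t τ r (fun _ => 1) w = W1 at *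
  generalize wNorm ε t τ r (fun ξ => |ξ|) w = W2 at *
  generalize wNorm ε t τ r brak w = W3 at *
  generalize wNorm ε t τ r (fun _ => 1) (fun ξ y => deriv (w ξ) y) = W4 at *
  generalize aNorm τ r (fun _ => 1) A = A1 at *
  generalize aNorm τ r (fun ξ => |ξ|) A = A2 at *
  generalize aNorm τ r brak A = A3 at *
  rw [← ENNReal.ofReal_toReal (Kn_ne_top hr)] at h
  generalize (Kn r).toReal = K at *
  generalize (2:ℝ) ^ (r + 1) = R at *
  have hei : 0 < ε⁻¹ := by positivity
  have e : (216 * (ENNReal.ofReal ε⁻¹ * (ENNReal.ofReal A1 * ENNReal.ofReal W1)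
      + ENNReal.ofReal A3 * ENNReal.ofReal W4 + ENNReal.ofReal W2 ^ 2
      + (ENNReal.ofReal R * (2 * ENNReal.ofReal K)) *
        (ENNReal.ofReal W3 * ENNReal.ofReal A2 * ENNReal.ofReal A1))) =
      ENNReal.ofReal (216 * (ε⁻¹ * (A1 * W1) + A3 * W4 + W2 ^ 2
        + (R * (2 * K)) * (W3 * A2 * A1))) := by
    rw [ENNReal.ofReal_mul (by norm_num), ENNReal.ofReal_add (by positivity) (by positivity),
      ENNReal.ofReal_add (by positivity) (by positivity),
      ENNReal.ofReal_add (by positivity) (by positivity),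
      ENNReal.ofReal_mul hei.le, ENNReal.ofReal_mul b1, ENNReal.ofReal_mul b3,
      ENNReal.ofReal_pow n2, ENNReal.ofReal_mul (by positivity), ENNReal.ofReal_mul h2.le,
      ENNReal.ofReal_mul (by norm_num : (0:ℝ) ≤ 2), ENNReal.ofReal_mul (by positivity),
      ENNReal.ofReal_mul n3]
    norm_num
  rw [e, ← ofReal_norm, ENNReal.ofReal_le_ofReal_iff (by positivity)] at h
  refine h.trans ?_
  have p1 : 0 ≤ ε⁻¹ * W1 * A1 := by positivity
  have p2 : 0 ≤ A3 * W4 := by positivity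
  have p3 : 0 ≤ W2 ^ 2 := by positivity
  have p4 : 0 ≤ W2 * W1 := by positivity
  have p5 : 0 ≤ W3 * A2 * A1 := by positivity
  have p6 : 0 ≤ R * (2 * K) := by positivity
  have q := mul_nonneg p6 (add_nonneg (add_nonneg p1 p2) (add_nonneg p3 p4))
  nlinarith
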